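/- Let n = 2k+1 ≥ 7 be odd and let q be a primitive n-th root of unity. Write A = [A(q)] and B = [B(q)] in PGL(2,ℂ), set S = A^k B^k A^{k−k²} B^{−1} A^k B^{−1} A^{k−k²} B^k A^k and T = A^k B^k A^{k−k²} B^{−1} A^{k+1} B A^{k+k²} B^k A^{5k}, and let N be the normal closure of {S, T} in Γ(q). Define f(n) = |PSL(2, ℤ/nℤ)| · (n−6)/(6n) (an integer; when n is prime, f(n) = (n+1)(n−1)(n−6)/12). Then any f(n) elements x₁, …, x_{f(n)} of N generate a free subgroup of Γ(q). -/

import Mathlib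

open Matrix

/-- The matrix `A(q)` (image of `g₁²` under the reduced Burau representation `β₋q`),
as an element of `GL(2,ℂ)` (junk value `1` if `q = 0`). -/
noncomputable def AGL (q : ℂ) : GL (Fin 2) ℂ :=
  if h : q = 0 then 1 else
    Matrix.GeneralLinearGroup.mkOfDetNeZero !![q ^ 2, 1 + q; 0, 1]
      (by rw [Matrix.det_fin_two_of]; simpa using pow_ne_zero 2 h)

/-- The matrix `B(q)` (image of `g₂²` under the reduced Burau representation `β₋q`),
as an element of `GL(2,ℂ)` (junk value `1` if `q = 0`). -/
noncomputable def BGL (q : ℂ) : GL (Fin 2) ℂ :=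
  if h : q = 0 then 1 else
    Matrix.GeneralLinearGroup.mkOfDetNeZero !![1, 0; -q - q ^ 2, q ^ 2]
      (by rw [Matrix.det_fin_two_of]; simpa using pow_ne_zero 2 h)

/-- `PGL(2,ℂ)`: the quotient of `GL(2,ℂ)` by its center. -/
abbrev PGL2 : Type := GL (Fin 2) ℂ ⧸ Subgroup.center (GL (Fin 2) ℂ)

/-- The canonical projection `GL(2,ℂ) → PGL(2,ℂ)`. -/
noncomputable def pgl : GL (Fin 2) ℂ →* PGL2 := QuotientGroup.mk' _

/-- The class `[A(q)] ∈ PGL(2,ℂ)`. -/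
noncomputable def Apr (q : ℂ) : PGL2 := pgl (AGL q)

/-- The class `[B(q)] ∈ PGL(2,ℂ)`. -/
noncomputable def Bpr (q : ℂ) : PGL2 := pgl (BGL q)

/-- The group `Γ(q) = Γ₋q ⊆ PGL(2,ℂ)` generated by `[A(q)]` and `[B(q)]`. -/
noncomputable def Gamma (q : ℂ) : Subgroup PGL2 := Subgroup.closure {Apr q, Bpr q}

/-- Relators of the triangle group `Δ(l,m,n) = ⟨x,y | x^l = y^m = (xy)^n = 1⟩`. -/
def triangleRels (l m n : ℕ) : Set (FreeGroup (Fin 2)) :=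
  {(FreeGroup.of 0) ^ l, (FreeGroup.of 1) ^ m, (FreeGroup.of 0 * FreeGroup.of 1) ^ n}

/-- The triangle group `Δ(l,m,n)`. -/
abbrev Triangle (l m n : ℕ) := PresentedGroup (triangleRels l m n)

/-- `PSL(2, ℤ/nℤ)`: the quotient of `SL(2, ℤ/nℤ)` by its center. -/
abbrev PSLZ (n : ℕ) : Type :=
  Matrix.SpecialLinearGroup (Fin 2) (ZMod n) ⧸
    Subgroup.center (Matrix.SpecialLinearGroup (Fin 2) (ZMod n))

/-- The canonical projection `SL(2, ℤ/nℤ) → PSL(2, ℤ/nℤ)`. -/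
def pslMk (n : ℕ) : Matrix.SpecialLinearGroup (Fin 2) (ZMod n) →* PSLZ n :=
  QuotientGroup.mk' _

/-- The matrix `((1,−1),(0,1))` as an element of `SL(2, ℤ/nℤ)`. -/
def slA (n : ℕ) : Matrix.SpecialLinearGroup (Fin 2) (ZMod n) :=
  ⟨!![1, -1; 0, 1], by norm_num [Matrix.det_fin_two_of]⟩

/-- The matrix `((1,−1),(1,0))` as an element of `SL(2, ℤ/nℤ)`. -/
def slU (n : ℕ) : Matrix.SpecialLinearGroup (Fin 2) (ZMod n) :=
  ⟨!![1, -1; 1, 0], by norm_num [Matrix.det_fin_two_of]⟩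

/-- The matrix `((0,−1),(1,0))` as an element of `SL(2, ℤ/nℤ)`. -/
def slV (n : ℕ) : Matrix.SpecialLinearGroup (Fin 2) (ZMod n) :=
  ⟨!![0, -1; 1, 0], by norm_num [Matrix.det_fin_two_of]⟩

/-- `[A(q)]` as an element of the subgroup `Γ(q)`. -/
noncomputable def Ain (q : ℂ) : ↥(Gamma q) :=
  ⟨Apr q, Subgroup.subset_closure (Set.mem_insert _ _)⟩

/-- `[B(q)]` as an element of the subgroup `Γ(q)`. -/
noncomputable def Bin (q : ℂ) : ↥(Gamma q) :=
  ⟨Bpr q, Subgroup.subset_closure (Set.mem_insert_of_mem _ rfl)⟩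

/-- The element `S = A^k B^k A^(k−k²) B⁻¹ A^k B⁻¹ A^(k−k²) B^k A^k` of `Γ(q)`
(image under Burau's representation of the braid word `s` of the paper). -/
noncomputable def Sel (q : ℂ) (k : ℕ) : ↥(Gamma q) :=
  Ain q ^ k * Bin q ^ k * Ain q ^ ((k : ℤ) - (k : ℤ) ^ 2) * (Bin q)⁻¹ * Ain q ^ k *
    (Bin q)⁻¹ * Ain q ^ ((k : ℤ) - (k : ℤ) ^ 2) * Bin q ^ k * Ain q ^ k

/-- The element `T = A^k B^k A^(k−k²) B⁻¹ A^(k+1) B A^(k+k²) B^k A^(5k)` of `Γ(q)`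
(image under Burau's representation of the braid word `t` of the paper). -/
noncomputable def Tel (q : ℂ) (k : ℕ) : ↥(Gamma q) :=
  Ain q ^ k * Bin q ^ k * Ain q ^ ((k : ℤ) - (k : ℤ) ^ 2) * (Bin q)⁻¹ * Ain q ^ (k + 1) *
    Bin q * Ain q ^ ((k : ℤ) + (k : ℤ) ^ 2) * Bin q ^ k * Ain q ^ (5 * k)

/-- In an infinite, connected, locally finite graph every vertex can be pointed at a neighbour in
such a way that there is no infinite chain of backward steps. -/
theorem SimpleGraph.Connected.exists_adj_wellFounded {V : Type*} [Infinite V] {Γ : SimpleGraph V}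
    (hc : Γ.Connected) (hfin : ∀ v, (Γ.neighborSet v).Finite) :
    ∃ next : V → V, (∀ v, Γ.Adj v (next v)) ∧ WellFounded (fun a b => next a = b) := by
  classical
  obtain ⟨r⟩ := hc.nonempty
  let d : V → ℕ := fun v => Γ.dist r v
  have hpar : ∀ v, v ≠ r → ∃ w, Γ.Adj v w ∧ d w + 1 = d v := by
    intro v hv
    obtain ⟨p, hp⟩ := hc.exists_walk_length_eq_dist v r
    cases p with
    | nil => exact absurd rfl hv
    | @cons _ w _ h p =>
      refine ⟨w, h, ?_⟩
      have h1 : Γ.dist w r ≤ p.length := Γ.dist_le p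
      have h2 : Γ.dist v r ≤ Γ.dist w r + 1 := by
        obtain ⟨p', hp'⟩ := hc.exists_walk_length_eq_dist w r
        rw [← hp']
        exact Γ.dist_le (SimpleGraph.Walk.cons h p')
      simp only [SimpleGraph.Walk.length_cons] at hp
      simp only [d, Γ.dist_comm (u := r)]
      omega
  have hdr : d r = 0 := by simp [d]
  let par : V → V := fun v => if h : v = r then r else (hpar v h).choose
  have par_adj : ∀ v, v ≠ r → Γ.Adj v (par v) := by
    intro v hv
    simpa [par, hv] using (hpar v hv).choose_spec.1
  have par_d : ∀ v, v ≠ r → d (par v) + 1 = d v := by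
    intro v hv
    simpa [par, hv] using (hpar v hv).choose_spec.2
  have par_r : par r = r := by simp [par]
  have par_le : ∀ i v, d (par^[i] v) ≤ d v := by
    intro i
    induction i with
    | zero => intro v; simp
    | succ i ih =>
      intro v
      rw [Function.iterate_succ_apply]
      refine (ih _).trans ?_
      by_cases hv : v = r
      · simp [hv, par_r]
      · have := par_d v hv; omega
  let D : V → Set V := fun v => {w | ∃ i, par^[i] w = v}
  have D_self : ∀ v, v ∈ D v := fun v => ⟨0, rfl⟩
  have D_root : D r = Set.univ := by
    ext w
    simp only [D, Set.mem_ofPred_eq, Set.mem_univ, iff_true]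
    induction hw : d w generalizing w with
    | zero =>
      by_cases h : w = r
      · exact ⟨0, h⟩
      · have := par_d w h; omega
    | succ k ih =>
      have h : w ≠ r := by rintro rfl; omega
      have := par_d w h
      obtain ⟨i, hi⟩ := ih (par w) (by omega)
      exact ⟨i + 1, hi⟩
  have D_child : ∀ v, v ≠ r → D v ⊆ D (par v) := by
    rintro v - w ⟨i, rfl⟩
    exact ⟨i + 1, Function.iterate_succ_apply' par i w⟩
  have D_decomp : ∀ v, D v ⊆ {v} ∪ ⋃ c ∈ {c | c ≠ r ∧ par c = v}, D c := by
    rintro v w ⟨i, hi⟩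
    induction i generalizing w with
    | zero => left; exact hi
    | succ i ih =>
      rcases ih hi with h | h
      · by_cases hw : w = r
        · subst hw
          left; rw [par_r] at h; exact h
        · right
          simp only [Set.mem_iUnion]
          exact ⟨w, ⟨hw, h⟩, D_self w⟩
      · right
        simp only [Set.mem_iUnion] at h ⊢
        obtain ⟨c, hc, j, hj⟩ := h
        exact ⟨c, hc, j + 1, hj⟩
  have key : ∀ v, (D v).Infinite → ∃ c, c ≠ r ∧ par c = v ∧ (D c).Infinite := by
    intro v hv
    by_contra! hcon
    refine hv (Set.Finite.subset ((Set.finite_singleton v).union (Set.Finite.biUnion ?_ ?_))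
      (D_decomp v))
    · refine (hfin v).subset ?_
      rintro c ⟨hc, rfl⟩
      exact (par_adj c hc).symm
    · rintro c ⟨hc, hcv⟩
      exact hcon c hc hcv
  let next : V → V := fun v => if h : (D v).Infinite then (key v h).choose else par v
  have next_inf : ∀ v, (D v).Infinite →
      next v ≠ r ∧ par (next v) = v ∧ (D (next v)).Infinite := by
    intro v h
    have := (key v h).choose_spec
    simpa only [next, dif_pos h] using this
  have next_fin : ∀ v, ¬ (D v).Infinite → next v = par v := fun v h => by
    simp only [next, dif_neg h]
  have r_inf : (D r).Infinite := by rw [D_root]; exact Set.infinite_univ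
  refine ⟨next, fun v => ?_, ⟨?_⟩⟩
  · by_cases h : (D v).Infinite
    · obtain ⟨h1, h2, -⟩ := next_inf v h
      have := par_adj _ h1
      rw [h2] at this
      exact this.symm
    · rw [next_fin v h]
      refine par_adj v ?_
      rintro rfl
      exact h r_inf
  · have acc_fin : ∀ k v, ¬ (D v).Infinite → (D v).ncard = k →
        Acc (fun a b => next a = b) v := by
      intro k
      induction k using Nat.strong_induction_on with
      | _ k ih =>
        intro v hv hk
        refine ⟨_, fun u hu => ?_⟩
        have hu' : ¬ (D u).Infinite := fun h => hv (hu ▸ (next_inf u h).2.2)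
        have hur : u ≠ r := by rintro rfl; exact hu' r_inf
        rw [next_fin u hu'] at hu
        refine ih _ ?_ u hu' rfl
        rw [← hk]
        refine Set.ncard_lt_ncard ⟨?_, fun h => ?_⟩ (Set.not_infinite.1 hv)
        · rw [← hu]; exact D_child u hur
        · obtain ⟨i, hi⟩ := h (D_self v)
          have h1 := par_le i v
          have h2 := par_d u hur
          rw [hi] at h1
          rw [hu] at h2
          omega
    have acc_inf : ∀ k v, (D v).Infinite → d v = k → Acc (fun a b => next a = b) v := by
      intro k
      induction k using Nat.strong_induction_on with
      | _ k ih =>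
        intro v hv hk
        refine ⟨_, fun u hu => ?_⟩
        by_cases hu' : (D u).Infinite
        · obtain ⟨h1, h2, -⟩ := next_inf u hu'
          rw [hu] at h1 h2
          have := par_d v h1
          rw [h2] at this
          exact ih (d u) (by omega) u hu' rfl
        · exact acc_fin _ u hu' rfl
    intro v
    by_cases hv : (D v).Infinite
    · exact acc_inf _ v hv rfl
    · exact acc_fin _ v hv rfl

open CategoryTheory CategoryTheory.ActionCategory Quiver in
/-- Let a group presented by generators `α` and relators `rels` act on `A`. -/
theorem PresentedGroup.exists_isFreeGroupoid {α A : Type} {rels : Set (FreeGroup α)}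
    [MulAction (PresentedGroup rels) A] (S : α → Set A)
    (hS : ∀ (X : Type) [Group X] (l : α → A → X), ∃! w : α → A → X,
      (∀ i, ∀ b ∈ S i, w i b = l i b) ∧
      ∀ r ∈ rels, FreeGroup.lift (fun i => (⟨w i, PresentedGroup.of i⟩ :
        (A → X) ⋊[mulAutArrow] PresentedGroup rels)) r = 1) :
    Nonempty (IsFreeGroupoid (ActionCategory (PresentedGroup rels) A)) := by
  classical
  refine ⟨{ quiverGenerators := ⟨fun a b => { i : α //
              (PresentedGroup.of i : PresentedGroup rels) • a.back = b.back ∧ b.back ∈ S i }⟩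
            of := fun e => ⟨PresentedGroup.of e.1, e.2.1⟩
            unique_lift := ?_ }⟩
  intro X _ f
  let l : α → A → X := fun i b => if h : b ∈ S i then
    @f ⟨(), (PresentedGroup.of i : PresentedGroup rels)⁻¹ • b⟩ ⟨(), b⟩
      ⟨i, smul_inv_smul _ b, h⟩ else 1
  obtain ⟨w, ⟨hw1, hw2⟩, hw3⟩ := hS X l
  let F' : PresentedGroup rels →* (A → X) ⋊[mulAutArrow] PresentedGroup rels :=
    PresentedGroup.toGroup hw2
  have hF' : ∀ i, F' (PresentedGroup.of i) = ⟨w i, PresentedGroup.of i⟩ := fun i =>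
    PresentedGroup.toGroup.of hw2
  refine ⟨uncurry F' ?_, ?_, ?_⟩
  · suffices SemidirectProduct.rightHom.comp F' = MonoidHom.id _ by
      exact DFunLike.ext_iff.mp this
    refine PresentedGroup.ext (fun x ↦ ?_)
    rw [MonoidHom.comp_apply, hF']
    rfl
  · rintro ⟨⟨⟩, a : A⟩ ⟨⟨⟩, b : A⟩ ⟨e, h : PresentedGroup.of e • a = b, h' : b ∈ S e⟩
    change (F' (PresentedGroup.of _)).left _ = _
    rw [hF']
    cases inv_smul_eq_iff.mpr h.symm
    change w e b = _
    rw [hw1 e b h']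
    exact dif_pos h'
  · intro E hE
    have hc : (fun i => (curry E (PresentedGroup.of i)).left) = w := by
      apply hw3
      constructor
      · intro i b hb
        simp only [l, dif_pos hb]
        exact hE ⟨(), (PresentedGroup.of i : PresentedGroup rels)⁻¹ • b⟩ ⟨(), b⟩
          ⟨i, smul_inv_smul _ b, hb⟩
      · intro r hr
        have : FreeGroup.lift (fun i => (⟨(curry E (PresentedGroup.of i)).left,
            PresentedGroup.of i⟩ : (A → X) ⋊[mulAutArrow] PresentedGroup rels)) =
            (curry E).comp (PresentedGroup.mk rels) := by
          ext i
          · simp; rfl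
          · simp; rfl
        rw [this, MonoidHom.comp_apply, PresentedGroup.one_of_mem hr, map_one]
    have : curry E = F' := by
      refine PresentedGroup.ext (fun i => ?_)
      rw [hF', ← hc]
      rfl
    apply Functor.hext
    · intro
      apply Unit.ext
    · refine ActionCategory.cases ?_
      intro t g
      exact heq_of_eq (congrArg (fun h => (h g).left t) this)

section CyclicProducts

variable {G A X : Type*} [Group G] [MulAction G A] [Group X]

/-- The product of the values of `w` along `m` steps of the backward `g`-orbit of `b`. -/
def orbitProd (m : ℕ) (w : A → X) (g : G) (b : A) : X :=
  ((List.range m).map fun i => w (g⁻¹ ^ i • b)).prod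

theorem SemidirectProduct.pow_left_apply (w : A → X) (g : G) (m : ℕ) (b : A) :
    ((⟨w, g⟩ : (A → X) ⋊[mulAutArrow] G) ^ m).left b = orbitProd m w g b := by
  induction m with
  | zero => simp [orbitProd]
  | succ m ih =>
    have hr : ((⟨w, g⟩ : (A → X) ⋊[mulAutArrow] G) ^ m).right = g ^ m := by
      rw [← SemidirectProduct.rightHom_eq_right, map_pow]
      rfl
    rw [pow_succ, SemidirectProduct.mul_left, Pi.mul_apply, ih, hr, orbitProd, orbitProd,
      List.range_succ, List.map_append, List.prod_append]
    simp only [List.map_cons, List.map_nil, List.prod_cons, List.prod_nil, mul_one, inv_pow]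
    rfl

theorem SemidirectProduct.pow_eq_one_iff (w : A → X) {g : G} {m : ℕ} (hg : g ^ m = 1) :
    (⟨w, g⟩ : (A → X) ⋊[mulAutArrow] G) ^ m = 1 ↔ ∀ b, orbitProd m w g b = 1 := by
  have hr : ((⟨w, g⟩ : (A → X) ⋊[mulAutArrow] G) ^ m).right = 1 := by
    rw [← SemidirectProduct.rightHom_eq_right, map_pow]
    exact hg
  constructor
  · intro h b
    rw [← pow_left_apply, h]
    rfl
  · intro h
    ext b
    · rw [pow_left_apply, h]
      rfl
    · exact hr

theorem orbitProd_mul_comm (w : A → X) {g : G} {m : ℕ} (hg : g ^ m = 1) (b : A) :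
    orbitProd m w g b * w b = w b * orbitProd m w g (g⁻¹ • b) := by
  have h1 : orbitProd (m + 1) w g b = orbitProd m w g b * w b := by
    rw [orbitProd, List.range_succ, List.map_append, List.prod_append]
    simp [orbitProd, inv_pow, hg]
  have h2 : orbitProd (m + 1) w g b = w b * orbitProd m w g (g⁻¹ • b) := by
    rw [orbitProd, List.range_succ_eq_map, List.map_cons, List.prod_cons, List.map_map]
    simp only [orbitProd, Function.comp_def, pow_succ, mul_smul, pow_zero, one_smul]
  rw [← h1, h2]

theorem orbitProd_eq_one_of_exists (w : A → X) {g : G} {m : ℕ} (hg : g ^ m = 1)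
    (h : ∀ b, ∃ j : ℕ, orbitProd m w g (g ^ j • b) = 1) (b : A) : orbitProd m w g b = 1 := by
  have step : ∀ b, orbitProd m w g (g • b) = 1 → orbitProd m w g b = 1 := by
    intro b hb
    have := orbitProd_mul_comm w hg (g • b)
    rw [hb, one_mul, inv_smul_smul] at this
    simpa using this
  obtain ⟨j, hj⟩ := h b
  induction j with
  | zero => simpa using hj
  | succ j ih =>
    rw [pow_succ', mul_smul] at hj
    exact ih (step _ hj)

/-- A set of representatives for the orbits of an element of finite order. -/
theorem exists_orbit_transversal (A : Type*) [MulAction G A] {g : G} {m : ℕ} (hm : 0 < m)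
    (hg : g ^ m = 1) :
    ∃ Q : Set A, (∀ a, ∃ j : ℕ, g ^ j • a ∈ Q) ∧
      ∀ a ∈ Q, ∀ i : ℕ, g ^ i • a ∈ Q → g ^ i • a = a := by
  let s := MulAction.orbitRel (Subgroup.zpowers g) A
  refine ⟨{a | (Quotient.mk s a).out = a}, fun a => ?_, fun a ha i hi => ?_⟩
  · have h : s (Quotient.mk s a).out a := Quotient.exact (Quotient.out_eq _)
    obtain ⟨⟨c, hc⟩, hc'⟩ := MulAction.orbitRel_apply.1 h
    have hfin : IsOfFinOrder g := isOfFinOrder_iff_pow_eq_one.2 ⟨m, hm, hg⟩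
    obtain ⟨j, rfl⟩ := hfin.mem_powers_iff_mem_zpowers.2 hc
    refine ⟨j, ?_⟩
    have h2 : g ^ j • a = (Quotient.mk s a).out := hc'
    rw [h2]
    simp
  · have h : Quotient.mk s (g ^ i • a) = Quotient.mk s a :=
      Quotient.sound (MulAction.orbitRel_apply.2 ⟨⟨g ^ i, i, by simp⟩, rfl⟩)
    have h1 : (Quotient.mk s (g ^ i • a)).out = g ^ i • a := hi
    rw [← h1, h]
    exact ha

end CyclicProducts

theorem WellFounded.existsUnique_eq_apply {F X : Type*} [Nonempty X] {r : F → F → Prop}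
    (wf : WellFounded r) (Φ : F → (F → X) → X)
    (h : ∀ f v v', (∀ f', r f' f → v f' = v' f') → Φ f v = Φ f v') :
    ∃! v : F → X, ∀ f, v f = Φ f v := by
  classical
  let v : F → X := wf.fix fun f rec =>
    Φ f fun f' => if h : r f' f then rec f' h else Classical.arbitrary X
  have hv : ∀ f, v f = Φ f v := by
    intro f
    refine (wf.fix_eq _ f).trans (h f _ _ fun f' hf' => ?_)
    rw [dif_pos hf']
  refine ⟨v, hv, fun v' hv' => funext fun f => ?_⟩
  induction f using wf.induction with
  | _ f ih => rw [hv, hv', h f _ _ ih]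

theorem exists_section_wellFounded {A F : Type*} [Infinite A] {π : A → F}
    (hπ : Function.Surjective π) (hfib : ∀ f, (π ⁻¹' {f}).Finite) {x : A → A}
    (hx : ∀ a, x (x a) = a)
    (hconn : ∀ a b, Relation.ReflTransGen (fun a b => b = x a ∨ π a = π b) a b) :
    ∃ B : F → A, (∀ f, π (B f) = f) ∧ WellFounded fun f f' => π (x (B f)) = f' := by
  let Γ : SimpleGraph F := SimpleGraph.fromRel fun f f' => ∃ b, π b = f ∧ π (x b) = f'
  have hadj : ∀ f f', Γ.Adj f f' → ∃ b, π b = f ∧ π (x b) = f' := by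
    rintro f f' ⟨-, h | ⟨b, hb, hb'⟩⟩
    · exact h
    · exact ⟨x b, hb', by rw [hx, hb]⟩
  have : Infinite F := by
    by_contra hF
    rw [not_infinite_iff_finite] at hF
    refine Set.infinite_univ (α := A) ?_
    exact Set.Finite.of_finite_fibers π (Set.toFinite _) fun f _ =>
      (hfib f).subset Set.inter_subset_right
  have hreach : ∀ a b, Γ.Reachable (π a) (π b) := by
    intro a b
    induction hconn a b with
    | refl => exact SimpleGraph.Reachable.refl _
    | @tail b c _ h ih =>
      refine ih.trans ?_
      rcases h with rfl | h
      · by_cases h : π b = π (x b)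
        · rw [← h]
        · exact SimpleGraph.Adj.reachable ⟨h, Or.inl ⟨b, rfl, rfl⟩⟩
      · rw [h]
  have hc : Γ.Connected :=
    { preconnected := fun f f' => by
        obtain ⟨a, rfl⟩ := hπ f
        obtain ⟨b, rfl⟩ := hπ f'
        exact hreach a b
      nonempty := inferInstance }
  obtain ⟨next, hn1, hn2⟩ := hc.exists_adj_wellFounded fun f =>
    ((hfib f).image fun b => π (x b)).subset fun f' hf' => by
      obtain ⟨b, hb, hb'⟩ := hadj f f' hf'
      exact ⟨b, hb, hb'⟩
  choose B hB1 hB2 using fun f => hadj f (next f) (hn1 f)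
  refine ⟨B, hB1, ?_⟩
  simpa only [hB2] using hn2

theorem exists_free_labels_triangle {G A : Type} [Group G] [MulAction G A] [Infinite A]
    [MulAction.IsPretransitive G A] {x y : G} (hgen : Subgroup.closure {x, y} = ⊤) {n : ℕ}
    (hx : x ^ 2 = 1) (hy : y ^ 3 = 1) (hz : (x * y) ^ n = 1)
    (fx : ∀ a : A, x • a ≠ a) (fy : ∀ a : A, y • a ≠ a)
    (fz : ∀ i : ℕ, 0 < i → i < n → ∀ a : A, (x * y) ^ i • a ≠ a) (hn : 0 < n) :
    ∃ S₀ S₁ : Set A, ∀ (X : Type) [Group X] (l₀ l₁ : A → X), ∃! p : (A → X) × (A → X),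
      (∀ b ∈ S₀, p.1 b = l₀ b) ∧ (∀ b ∈ S₁, p.2 b = l₁ b) ∧
      (∀ b, orbitProd 2 p.1 x b = 1) ∧ (∀ b, orbitProd 3 p.2 y b = 1) ∧
      ∀ b, orbitProd n (fun b => p.1 b * p.2 (x⁻¹ • b)) (x * y) b = 1 := by
  classical
  obtain ⟨n, rfl⟩ : ∃ k, n = k + 1 := ⟨n - 1, by omega⟩
  have hxinv : x⁻¹ = x := by rw [inv_eq_iff_mul_eq_one, ← pow_two, hx]
  have hxx : ∀ a : A, x • x • a = a := fun a => by rw [smul_smul, ← pow_two, hx, one_smul]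
  set z := x * y with hzdef
  let s := MulAction.orbitRel (Subgroup.zpowers z) A
  let π : A → Quotient s := Quotient.mk s
  have hzfin : IsOfFinOrder z := isOfFinOrder_iff_pow_eq_one.2 ⟨n + 1, hn, hz⟩
  have hπz : ∀ g ∈ Subgroup.zpowers z, ∀ a, π (g • a) = π a := fun g hg a =>
    Quotient.sound (MulAction.orbitRel_apply.2 ⟨⟨g, hg⟩, rfl⟩)
  have hπe : ∀ a b, π a = π b → ∃ j : ℕ, z ^ j • b = a := by
    intro a b h
    obtain ⟨⟨c, hc⟩, hc'⟩ := MulAction.orbitRel_apply.1 (Quotient.exact h)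
    obtain ⟨j, rfl⟩ := hzfin.mem_powers_iff_mem_zpowers.2 hc
    exact ⟨j, hc'⟩
  obtain ⟨B, hB, hwf⟩ : ∃ B : Quotient s → A, (∀ f, π (B f) = f) ∧
      WellFounded fun f f' => π (x • B f) = f' := by
    refine exists_section_wellFounded (x := fun a => x • a) Quotient.mk_surjective ?_ hxx ?_
    · intro f
      obtain ⟨b, rfl⟩ := Quotient.mk_surjective f
      have : Finite (Subgroup.zpowers z) := hzfin.finite_zpowers.to_subtype
      refine (Set.finite_range fun g : Subgroup.zpowers z => g • b).subset ?_
      intro a ha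
      obtain ⟨c, hc⟩ := MulAction.orbitRel_apply.1 (Quotient.exact ha)
      exact ⟨c, hc⟩
    · intro a b
      obtain ⟨g, rfl⟩ := MulAction.exists_smul_eq G a b
      have hz' : z ∈ Subgroup.zpowers z := Subgroup.mem_zpowers z
      have hX : ∀ a, Relation.ReflTransGen (fun a b => b = x • a ∨ π a = π b) a (x • a) :=
        fun a => .single (Or.inl rfl)
      have hY : ∀ a, Relation.ReflTransGen (fun a b => b = x • a ∨ π a = π b) a (y • a) := by
        intro a
        have : y • a = x • z • a := by rw [hzdef, mul_smul, hxx]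
        rw [this]
        exact .tail (.single (Or.inr (hπz z hz' a).symm)) (Or.inl rfl)
      have hY' : ∀ a, Relation.ReflTransGen (fun a b => b = x • a ∨ π a = π b) a (y⁻¹ • a) := by
        intro a
        have : y⁻¹ • a = y • y • a := by
          rw [smul_smul, inv_smul_eq_iff, smul_smul, ← pow_two, ← pow_succ', hy, one_smul]
        rw [this]
        exact (hY a).trans (hY _)
      have hg : g ∈ Subgroup.closure {x, y} := by rw [hgen]; trivial
      induction hg using Subgroup.closure_induction_left generalizing a with
      | one => rw [one_smul]
      | mul_left u hu v _ ih =>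
        rw [mul_smul]
        rcases hu with rfl | rfl
        · exact (ih a).trans (hX _)
        · exact (ih a).trans (hY _)
      | inv_mul_cancel u hu v _ ih =>
        rw [mul_smul]
        rcases hu with rfl | rfl
        · rw [hxinv]; exact (ih a).trans (hX _)
        · exact (ih a).trans (hY' _)
  obtain ⟨Q, hQ1, hQ2⟩ := exists_orbit_transversal A (by norm_num : 0 < 3) hy
  have hy2 : y⁻¹ = y ^ 2 := by rw [inv_eq_iff_mul_eq_one, ← pow_succ', hy]
  have hQ3 : ∀ a ∈ Q, y⁻¹ • a ∉ Q := by
    intro a ha h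
    rw [hy2] at h
    have := hQ2 a ha 2 h
    rw [← hy2, inv_smul_eq_iff] at this
    exact fy a this.symm
  have hQ4 : ∀ a ∈ Q, y⁻¹ • y⁻¹ • a ∉ Q := by
    intro a ha h
    have e : y⁻¹ * y⁻¹ = y := by
      rw [hy2, ← pow_add, show 2 + 2 = 3 + 1 from rfl, pow_succ, hy, one_mul]
    rw [smul_smul, e, ← pow_one y] at h
    have := hQ2 a ha 1 h
    rw [pow_one] at this
    exact fy a this
  let Bs : Set A := Set.range B
  have hBs : ∀ a ∈ Bs, x • a ∉ Bs := by
    rintro _ ⟨f, rfl⟩ ⟨f', hf'⟩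
    have h1 : π (x • B f) = f' := by rw [← hf', hB]
    have h2 : π (x • B f') = f := by rw [hf', hxx, hB]
    exact hwf.asymmetric _ _ h1 h2
  have hBπ : ∀ a ∈ Bs, B (π a) = a := by
    rintro _ ⟨f, rfl⟩
    rw [hB]
  obtain ⟨R, hR1, hR2⟩ := exists_orbit_transversal A (by norm_num : 0 < 2) hx
  have hR3 : ∀ a ∈ R, x • a ∉ R := fun a ha h => fx a (by
    have := hR2 a ha 1 (by rwa [pow_one]); rwa [pow_one] at this)
  have hR4 : ∀ a, a ∈ R ∨ x • a ∈ R := by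
    intro a
    obtain ⟨j, hj⟩ := hR1 a
    rcases Nat.even_or_odd' j with ⟨i, rfl | rfl⟩
    · left; rwa [pow_mul, hx, one_pow, one_smul] at hj
    · right; rwa [pow_succ, pow_mul, hx, one_pow, one_mul] at hj
  let S₀ : Set A := {a | a ∉ Bs ∧ x • a ∉ Bs ∧ a ∈ R}
  refine ⟨S₀, Qᶜ, fun X _ l₀ l₁ => ?_⟩
  have op2 : ∀ (u : A → X) b, orbitProd 2 u x b = u b * u (x • b) := by
    intro u b; simp [orbitProd, List.range_succ, hxinv]
  have op3 : ∀ (v : A → X) b,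
      orbitProd 3 v y b = v b * v (y⁻¹ • b) * v (y⁻¹ • y⁻¹ • b) := by
    intro u b; simp [orbitProd, List.range_succ, smul_smul, pow_two, mul_assoc]
  let v : A → X := fun a =>
    if a ∈ Q then (l₁ (y⁻¹ • a) * l₁ (y⁻¹ • y⁻¹ • a))⁻¹ else l₁ a
  have hv1 : ∀ b ∈ Qᶜ, v b = l₁ b := fun b hb => if_neg hb
  have hv2 : ∀ b, orbitProd 3 v y b = 1 := by
    refine orbitProd_eq_one_of_exists v hy fun b => ?_
    obtain ⟨j, hj⟩ := hQ1 b
    refine ⟨j, ?_⟩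
    rw [op3, hv1 _ (hQ3 _ hj), hv1 _ (hQ4 _ hj)]
    simp only [v, if_pos hj]
    group
  have hv3 : ∀ v' : A → X, (∀ b ∈ Qᶜ, v' b = l₁ b) → (∀ b, orbitProd 3 v' y b = 1) → v' = v := by
    intro v' h1 h2
    funext b
    by_cases hb : b ∈ Q
    · have := h2 b
      rw [op3, h1 _ (hQ3 _ hb), h1 _ (hQ4 _ hb), mul_assoc] at this
      simp only [v, if_pos hb]
      exact eq_inv_of_mul_eq_one_left this
    · rw [hv1 b hb, h1 b hb]
  let U : (Quotient s → X) → A → X := fun val a =>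
    if a ∈ S₀ then l₀ a else if x • a ∈ S₀ then (l₀ (x • a))⁻¹ else
      if a ∈ Bs then val (π a) else (val (π (x • a)))⁻¹
  have hS : ∀ a, a ∈ S₀ → x • a ∉ S₀ := fun a ha h => hR3 a ha.2.2 h.2.2
  have hSB : ∀ a, a ∈ Bs → a ∉ S₀ ∧ x • a ∉ S₀ := fun a ha =>
    ⟨fun h => h.1 ha, fun h => h.2.1 (by rwa [hxx])⟩
  have hcase : ∀ a, a ∉ S₀ → x • a ∉ S₀ → a ∉ Bs → x • a ∈ Bs := by
    intro a h1 h2 h3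
    by_contra h4
    rcases hR4 a with h | h
    · exact h1 ⟨h3, h4, h⟩
    · exact h2 ⟨h4, by rwa [hxx], h⟩
  have hU1 : ∀ val, ∀ b ∈ S₀, U val b = l₀ b := fun val b hb => if_pos hb
  have hU2 : ∀ val f, U val (B f) = val f := by
    intro val f
    have h := hSB (B f) ⟨f, rfl⟩
    simp only [U, if_neg h.1, if_neg h.2, if_pos (show B f ∈ Bs from ⟨f, rfl⟩), hB]
  have hU3 : ∀ val b, orbitProd 2 (U val) x b = 1 := by
    intro val b
    rw [op2]
    by_cases h1 : b ∈ S₀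
    · simp only [U, if_pos h1, if_neg (hS b h1), hxx, mul_inv_cancel]
    · by_cases h2 : x • b ∈ S₀
      · simp only [U, if_pos h2, if_neg h1, inv_mul_cancel]
      · by_cases h3 : b ∈ Bs
        · simp only [U, if_neg h1, if_neg h2, if_pos h3, hxx, if_neg (hBs b h3), mul_inv_cancel]
        · simp only [U, if_neg h1, if_neg h2, if_neg h3, hxx, if_pos (hcase b h1 h2 h3),
            inv_mul_cancel]
  have hU4 : ∀ u : A → X, (∀ b ∈ S₀, u b = l₀ b) → (∀ b, orbitProd 2 u x b = 1) →
      u = U fun f => u (B f) := by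
    intro u h1 h2
    have h3 : ∀ b, u b = (u (x • b))⁻¹ := fun b => by
      have := h2 b
      rw [op2] at this
      exact eq_inv_of_mul_eq_one_left this
    funext b
    by_cases hb1 : b ∈ S₀
    · exact (h1 b hb1).trans (hU1 (fun f => u (B f)) b hb1).symm
    · by_cases hb2 : x • b ∈ S₀
      · simp only [U, if_neg hb1, if_pos hb2]
        rw [h3, h1 _ hb2]
      · by_cases hb3 : b ∈ Bs
        · simp only [U, if_neg hb1, if_neg hb2, if_pos hb3, hBπ b hb3]
        · simp only [U, if_neg hb1, if_neg hb2, if_neg hb3]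
          rw [h3, hBπ _ (hcase b hb1 hb2 hb3)]
  let t : (A → X) → A → X := fun u b => u b * v (x⁻¹ • b)
  let P : (A → X) → Quotient s → X := fun u f =>
    ((List.range n).map fun i => t u (z⁻¹ ^ (i + 1) • B f)).prod
  have hP : ∀ u f, orbitProd (n + 1) (t u) z (B f) = u (B f) * v (x⁻¹ • B f) * P u f := by
    intro u f
    rw [orbitProd, List.range_succ_eq_map, List.map_cons, List.prod_cons, List.map_map]
    simp only [pow_zero, one_smul]
    rfl
  let Φ : Quotient s → (Quotient s → X) → X := fun f val => (v (x⁻¹ • B f) * P (U val) f)⁻¹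
  have hΦ : ∀ f val, (val f = Φ f val ↔ orbitProd (n + 1) (t (U val)) z (B f) = 1) := by
    intro f val
    rw [hP, hU2, mul_assoc, ← eq_inv_iff_mul_eq_one]
  have hdep : ∀ f val val', (∀ f', π (x • B f') = f → val f' = val' f') → Φ f val = Φ f val' := by
    intro f val val' h
    have hPP : P (U val) f = P (U val') f := by
      refine congrArg List.prod (List.map_congr_left fun i hi => ?_)
      have hi' : i < n := List.mem_range.1 hi
      set a := z⁻¹ ^ (i + 1) • B f with ha
      have haf : π a = f := by
        rw [ha, hπz _ (Subgroup.pow_mem _ (Subgroup.inv_mem _ (Subgroup.mem_zpowers z)) _), hB]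
      suffices U val a = U val' a by simp only [t, this]
      by_cases h1 : a ∈ S₀
      · simp only [U, if_pos h1]
      · by_cases h2 : x • a ∈ S₀
        · simp only [U, if_neg h1, if_pos h2]
        · by_cases h3 : a ∈ Bs
          · exfalso
            have h4 := hBπ a h3
            rw [haf] at h4
            refine fz (i + 1) (by omega) (by omega) (B f) ?_
            have h5 : z ^ (i + 1) • a = B f := by
              rw [ha, inv_pow, smul_inv_smul]
            rwa [← h4] at h5
          · simp only [U, if_neg h1, if_neg h2, if_neg h3]
            rw [h]
            rw [hBπ _ (hcase a h1 h2 h3), hxx, haf]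
    simp only [Φ, hPP]
  obtain ⟨val, hval, huniq⟩ := hwf.existsUnique_eq_apply Φ hdep
  refine ⟨(U val, v), ⟨hU1 val, hv1, hU3 val, hv2, ?_⟩, ?_⟩
  · refine orbitProd_eq_one_of_exists _ hz fun b => ?_
    obtain ⟨j, hj⟩ := hπe (B (π b)) b (hB _)
    exact ⟨j, by rw [hj]; exact (hΦ _ _).1 (hval _)⟩
  · rintro ⟨u, v'⟩ ⟨h1, h2, h3, h4, h5⟩
    obtain rfl := hv3 v' h2 h4
    have hu := hU4 u h1 h3
    have : (fun f => u (B f)) = val := 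
      huniq _ fun f => (hΦ f fun f => u (B f)).2 (by rw [← hu]; exact h5 _)
    exact Prod.ext (hu.trans (congrArg U this)) rfl

namespace Triangle

theorem of_zero_pow (l m n : ℕ) : (PresentedGroup.of 0 : Triangle l m n) ^ l = 1 :=
  PresentedGroup.one_of_mem (Or.inl rfl)

theorem of_one_pow (l m n : ℕ) : (PresentedGroup.of 1 : Triangle l m n) ^ m = 1 :=
  PresentedGroup.one_of_mem (Or.inr (Or.inl rfl))

theorem mul_pow (l m n : ℕ) :
    (PresentedGroup.of 0 * PresentedGroup.of 1 : Triangle l m n) ^ n = 1 :=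
  PresentedGroup.one_of_mem (Or.inr (Or.inr rfl))

theorem closure_eq_top (l m n : ℕ) :
    Subgroup.closure {(PresentedGroup.of 0 : Triangle l m n), PresentedGroup.of 1} = ⊤ := by
  rw [← PresentedGroup.closure_range_of]
  congr 1
  ext a
  simp [Fin.exists_fin_two, eq_comm]

end Triangle

theorem IsFreeGroupoid.isFreeGroup_of_end_equiv {C : Type} [CategoryTheory.Groupoid.{0} C]
    [CategoryTheory.IsConnected C] [IsFreeGroupoid C] (r : C) {H : Type} [Group H]
    (e : CategoryTheory.End r ≃ H) (he : ∀ a b, e (a * b) = e a * e b) : IsFreeGroup H :=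
  IsFreeGroup.ofMulEquiv { toEquiv := e, map_mul' := he }

theorem isFreeGroup_of_infinite_quotient_triangle {n : ℕ} (hn : 0 < n)
    (H : Subgroup (Triangle 2 3 n)) [Infinite (Triangle 2 3 n ⧸ H)]
    (fx : ∀ a : Triangle 2 3 n ⧸ H, (PresentedGroup.of 0 : Triangle 2 3 n) • a ≠ a)
    (fy : ∀ a : Triangle 2 3 n ⧸ H, (PresentedGroup.of 1 : Triangle 2 3 n) • a ≠ a)
    (fz : ∀ i : ℕ, 0 < i → i < n → ∀ a : Triangle 2 3 n ⧸ H,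
      (PresentedGroup.of 0 * PresentedGroup.of 1 : Triangle 2 3 n) ^ i • a ≠ a) :
    IsFreeGroup H := by
  obtain ⟨S₀, S₁, hS⟩ := exists_free_labels_triangle (A := Triangle 2 3 n ⧸ H)
    (Triangle.closure_eq_top 2 3 n) (Triangle.of_zero_pow 2 3 n) (Triangle.of_one_pow 2 3 n)
    (Triangle.mul_pow 2 3 n) fx fy fz hn
  have : Nonempty (IsFreeGroupoid (CategoryTheory.ActionCategory (Triangle 2 3 n)
      (Triangle 2 3 n ⧸ H))) := by
    refine PresentedGroup.exists_isFreeGroupoid ![S₀, S₁] fun X _ l => ?_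
    obtain ⟨⟨u, v⟩, ⟨h0, h1, h2, h3, h4⟩, hun⟩ := hS X (l 0) (l 1)
    have key : ∀ w : Fin 2 → Triangle 2 3 n ⧸ H → X,
        (∀ r ∈ triangleRels 2 3 n, FreeGroup.lift (fun i => (⟨w i, PresentedGroup.of i⟩ :
          (Triangle 2 3 n ⧸ H → X) ⋊[mulAutArrow] Triangle 2 3 n)) r = 1) ↔
        (∀ b, orbitProd 2 (w 0) (PresentedGroup.of 0 : Triangle 2 3 n) b = 1) ∧
        (∀ b, orbitProd 3 (w 1) (PresentedGroup.of 1 : Triangle 2 3 n) b = 1) ∧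
        ∀ b, orbitProd n (fun b => w 0 b * w 1 ((PresentedGroup.of 0 : Triangle 2 3 n)⁻¹ • b))
          (PresentedGroup.of 0 * PresentedGroup.of 1 : Triangle 2 3 n) b = 1 := by
      intro w
      rw [← SemidirectProduct.pow_eq_one_iff _ (Triangle.of_zero_pow 2 3 n),
        ← SemidirectProduct.pow_eq_one_iff _ (Triangle.of_one_pow 2 3 n),
        ← SemidirectProduct.pow_eq_one_iff _ (Triangle.mul_pow 2 3 n)]
      simp only [triangleRels, Set.mem_insert_iff, Set.mem_singleton_iff, forall_eq_or_imp,
        forall_eq, map_pow, map_mul, FreeGroup.lift_apply_of]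
      rfl
    refine ⟨![u, v], ⟨?_, (key _).2 ⟨h2, h3, h4⟩⟩, ?_⟩
    · exact Fin.forall_fin_two.2 ⟨h0, h1⟩
    · rintro w ⟨hw, hw'⟩
      obtain ⟨k0, k1, k2⟩ := (key w).1 hw'
      have := hun (w 0, w 1) ⟨hw 0, hw 1, k0, k1, k2⟩
      rw [Prod.mk.injEq] at this
      funext i
      fin_cases i
      · exact this.1
      · exact this.2
  obtain ⟨inst⟩ := this
  let e := CategoryTheory.ActionCategory.endMulEquivSubgroup H
  have hc : CategoryTheory.IsConnected
      (CategoryTheory.ActionCategory (Triangle 2 3 n) (Triangle 2 3 n ⧸ H)) := inferInstance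
  exact @IsFreeGroupoid.isFreeGroup_of_end_equiv _ _ hc inst _ _ _ e.toEquiv e.map_mul

theorem orbitProd_ofAdd {G A M : Type*} [Group G] [MulAction G A] [AddCommGroup M] (m : ℕ)
    (c : A → M) (g : G) (b : A) :
    orbitProd m (fun b => Multiplicative.ofAdd (c b)) g b =
      Multiplicative.ofAdd (∑ i ∈ Finset.range m, c (g⁻¹ ^ i • b)) := by
  rw [ofAdd_sum]
  rfl

theorem mul_card_orbit_transversal_le {G A : Type*} [Group G] [MulAction G A] [Finite A] {g : G}
    {m : ℕ} (hfree : ∀ i, 0 < i → i < m → ∀ a : A, g ^ i • a ≠ a) {Q : Set A}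
    (hQ : ∀ a ∈ Q, ∀ i : ℕ, g ^ i • a ∈ Q → g ^ i • a = a) :
    m * Nat.card Q ≤ Nat.card A := by
  have key : ∀ i j : ℕ, i ≤ j → j < m → ∀ a ∈ Q, ∀ b ∈ Q, g ^ i • a = g ^ j • b → i = j := by
    intro i j hij hj a ha b hb h
    obtain ⟨e, rfl⟩ := Nat.exists_eq_add_of_le hij
    rw [pow_add, mul_smul, smul_left_cancel_iff] at h
    by_contra hne
    refine hfree e (by omega) (by omega) b ?_
    exact hQ b hb e (h ▸ ha)
  have hinj : Function.Injective fun p : Fin m × Q => g ^ (p.1 : ℕ) • (p.2 : A) := by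
    rintro ⟨i, a, ha⟩ ⟨j, b, hb⟩ h
    have hij : (i : ℕ) = j := by
      rcases le_total (i : ℕ) j with hle | hle
      · exact key i j hle j.2 a ha b hb h
      · exact (key j i hle i.2 b hb a ha h.symm).symm
    obtain rfl := Fin.ext hij
    have : a = b := smul_left_cancel _ h
    subst this
    rfl
  simpa using Nat.card_le_card_of_injective _ hinj

theorem le_of_closure_range_triangle {n : ℕ} (hn : 0 < n) (H : Subgroup (Triangle 2 3 n))
    [Finite (Triangle 2 3 n ⧸ H)]
    (fx : ∀ a : Triangle 2 3 n ⧸ H, (PresentedGroup.of 0 : Triangle 2 3 n) • a ≠ a)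
    (fy : ∀ a : Triangle 2 3 n ⧸ H, (PresentedGroup.of 1 : Triangle 2 3 n) • a ≠ a)
    (fz : ∀ i : ℕ, 0 < i → i < n → ∀ a : Triangle 2 3 n ⧸ H,
      (PresentedGroup.of 0 * PresentedGroup.of 1 : Triangle 2 3 n) ^ i • a ≠ a)
    {m : ℕ} (h : Fin m → Triangle 2 3 n) (hH : H = Subgroup.closure (Set.range h)) :
    H.index * n + 6 * n ≤ 6 * n * m + 6 * H.index := by
  classical
  set A := Triangle 2 3 n ⧸ H with hA
  have : Fintype A := Fintype.ofFinite A
  set x : Triangle 2 3 n := PresentedGroup.of 0 with hx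
  set y : Triangle 2 3 n := PresentedGroup.of 1 with hy
  have hx2 : x ^ 2 = 1 := Triangle.of_zero_pow 2 3 n
  have hy3 : y ^ 3 = 1 := Triangle.of_one_pow 2 3 n
  have hzn : (x * y) ^ n = 1 := Triangle.mul_pow 2 3 n
  obtain ⟨Qx, hQx1, hQx2⟩ := exists_orbit_transversal A (by norm_num : 0 < 2) hx2
  obtain ⟨Qy, hQy1, hQy2⟩ := exists_orbit_transversal A (by norm_num : 0 < 3) hy3
  obtain ⟨Qz, hQz1, hQz2⟩ := exists_orbit_transversal A hn hzn
  have cQx := mul_card_orbit_transversal_le (m := 2) (fun i h1 h2 a => by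
    obtain rfl : i = 1 := by omega
    rw [pow_one]; exact fx a) hQx2
  have cQy := mul_card_orbit_transversal_le (m := 3) (fun i h1 h2 a => by
    rcases (by omega : i = 1 ∨ i = 2) with rfl | rfl
    · rw [pow_one]; exact fy a
    · intro h
      refine fy a ?_
      rw [← h, smul_smul, ← pow_succ', hy3, one_smul, h]) hQy2
  have cQz := mul_card_orbit_transversal_le fz hQz2
  let V := (A → ℚ) × (A → ℚ)
  let cx : A → Module.Dual ℚ V := fun b => LinearMap.proj b ∘ₗ LinearMap.fst ℚ _ _
  let cy : A → Module.Dual ℚ V := fun b => LinearMap.proj b ∘ₗ LinearMap.snd ℚ _ _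
  let cz : A → Module.Dual ℚ V := fun b => cx b + cy (x⁻¹ • b)
  let L : V →ₗ[ℚ] (Qx ⊕ Qy ⊕ Qz → ℚ) := LinearMap.pi (Sum.elim
    (fun b => ∑ i ∈ Finset.range 2, cx (x⁻¹ ^ i • (b : A))) (Sum.elim
    (fun b => ∑ i ∈ Finset.range 3, cy (y⁻¹ ^ i • (b : A)))
    (fun b => ∑ i ∈ Finset.range n, cz ((x * y)⁻¹ ^ i • (b : A)))))
  let K := LinearMap.ker L
  have hK : ∀ v : K, L v = 0 := fun v => v.2
  let res : Module.Dual ℚ V →ₗ[ℚ] Module.Dual ℚ K := Module.Dual.transpose K.subtype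
  let w : Fin 2 → A → Multiplicative (Module.Dual ℚ K) :=
    ![fun b => Multiplicative.ofAdd (res (cx b)), fun b => Multiplicative.ofAdd (res (cy b))]
  have hw : ∀ r ∈ triangleRels 2 3 n, FreeGroup.lift (fun i => (⟨w i, PresentedGroup.of i⟩ :
      (A → Multiplicative (Module.Dual ℚ K)) ⋊[mulAutArrow] Triangle 2 3 n)) r = 1 := by
    simp only [triangleRels, Set.mem_insert_iff, Set.mem_singleton_iff, forall_eq_or_imp,
        forall_eq, map_pow, map_mul, FreeGroup.lift_apply_of]
    refine ⟨(SemidirectProduct.pow_eq_one_iff _ hx2).2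
        (orbitProd_eq_one_of_exists _ hx2 fun b => ?_),
      (SemidirectProduct.pow_eq_one_iff _ hy3).2
        (orbitProd_eq_one_of_exists _ hy3 fun b => ?_),
      (SemidirectProduct.pow_eq_one_iff _ hzn).2
        (orbitProd_eq_one_of_exists _ hzn fun b => ?_)⟩
    · obtain ⟨j, hj⟩ := hQx1 b
      refine ⟨j, (orbitProd_ofAdd 2 (fun b => res (cx b)) _ _).trans ?_⟩
      rw [ofAdd_eq_one, ← map_sum]
      ext v
      exact congrFun (hK v) (Sum.inl ⟨_, hj⟩)
    · obtain ⟨j, hj⟩ := hQy1 b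
      refine ⟨j, (orbitProd_ofAdd 3 (fun b => res (cy b)) _ _).trans ?_⟩
      rw [ofAdd_eq_one, ← map_sum]
      ext v
      exact congrFun (hK v) (Sum.inr (Sum.inl ⟨_, hj⟩))
    · obtain ⟨j, hj⟩ := hQz1 b
      refine ⟨j, (orbitProd_ofAdd n (fun b => res (cz b)) _ _).trans ?_⟩
      rw [ofAdd_eq_one, ← map_sum]
      ext v
      exact congrFun (hK v) (Sum.inr (Sum.inr ⟨_, hj⟩))
  let F := PresentedGroup.toGroup hw
  have hF : ∀ i, F (PresentedGroup.of i) = ⟨w i, PresentedGroup.of i⟩ := fun i =>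
    PresentedGroup.toGroup.of hw
  have hFr : ∀ g, (F g).right = g := by
    suffices SemidirectProduct.rightHom.comp F = MonoidHom.id _ from DFunLike.ext_iff.mp this
    refine PresentedGroup.ext fun i => ?_
    rw [MonoidHom.comp_apply, hF]
    rfl
  let φ : Triangle 2 3 n → A → Module.Dual ℚ K := fun g b => Multiplicative.toAdd ((F g).left b)
  have hφ : ∀ g g' b, φ (g * g') b = φ g b + φ g' (g⁻¹ • b) := by
    intro g g' b
    simp only [φ, map_mul, SemidirectProduct.mul_left, hFr]
    rfl
  have hφ1 : ∀ b, φ 1 b = 0 := fun b => by simpa using hφ 1 1 b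
  let o : A := ((1 : Triangle 2 3 n) : Triangle 2 3 n ⧸ H)
  have hfix : ∀ g ∈ H, g⁻¹ • o = o := fun g hg => by
    rw [inv_smul_eq_iff]
    exact (QuotientGroup.eq.2 (by simpa using hg) : o = g • o)
  let γ : A → Triangle 2 3 n := Quotient.out
  have hγ : ∀ b, γ b • o = b := fun b =>
    (show γ b • o = ((γ b * 1 : Triangle 2 3 n) : Triangle 2 3 n ⧸ H) from rfl).trans
      (by rw [mul_one]; exact Quotient.out_eq b)
  have hinj : Function.Injective (LinearMap.pi (Sum.elim (fun i => φ (h i) o)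
      (fun b : {b : A // b ≠ o} => φ (γ b) b)) : K →ₗ[ℚ] Fin m ⊕ {b : A // b ≠ o} → ℚ) := by
    rw [injective_iff_map_eq_zero]
    intro v hv
    have h1 : ∀ i, φ (h i) o v = 0 := fun i => congrFun hv (Sum.inl i)
    have h2 : ∀ b (hb : b ≠ o), φ (γ b) b v = 0 := fun b hb => congrFun hv (Sum.inr ⟨b, hb⟩)
    have h3 : ∀ g ∈ Subgroup.closure (Set.range h), φ g o v = 0 := by
      intro g hg
      induction hg using Subgroup.closure_induction with
      | mem g hg =>
        obtain ⟨i, rfl⟩ := hg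
        exact h1 i
      | one => rw [hφ1]; rfl
      | mul g g' hg1 hg2 ih1 ih2 =>
        rw [hφ, hfix g (hH ▸ hg1), LinearMap.add_apply, ih1, ih2, add_zero]
      | inv g hg1 ih =>
        have := congrArg (· v) (hφ g⁻¹ g o)
        simp only [inv_mul_cancel, hφ1, hfix _ (hH ▸ inv_mem hg1), LinearMap.add_apply, ih,
          add_zero] at this
        exact this.symm
    have hstab : ∀ g, g • o = o → g ∈ Subgroup.closure (Set.range h) := fun g hg => by
      have := QuotientGroup.eq.1 (hg.symm : (((1 : Triangle 2 3 n)) : Triangle 2 3 n ⧸ H) =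
        ((g * 1 : Triangle 2 3 n) : Triangle 2 3 n ⧸ H))
      rw [← hH]
      simpa using this
    have h4 : ∀ g b, g • o = b → φ g b v = 0 := by
      intro g b hb
      by_cases hbo : b = o
      · rw [hbo] at hb ⊢
        exact h3 g (hstab g hb)
      · have h6 : (γ b)⁻¹ • b = o := inv_smul_eq_iff.2 (hγ b).symm
        have := h3 ((γ b)⁻¹ * g) (hstab _ (by rw [mul_smul, hb, h6]))
        rw [← mul_inv_cancel_left (γ b) g, hφ, LinearMap.add_apply, h2 b hbo, h6, this, add_zero]
    have h5 : ∀ g b, φ g b v = 0 := by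
      intro g b
      have := h4 (g * γ (g⁻¹ • b)) b (by rw [mul_smul, hγ, smul_inv_smul])
      rw [hφ, LinearMap.add_apply, h4 (γ (g⁻¹ • b)) _ (hγ _), add_zero] at this
      exact this
    ext b
    · have := h5 x b
      simp only [φ, hx, hF] at this
      exact this
    · have := h5 y b
      simp only [φ, hy, hF] at this
      exact this
  have hdim := LinearMap.finrank_le_finrank_of_injective hinj
  have hrn := LinearMap.finrank_range_add_finrank_ker L
  have hr := Submodule.finrank_le (LinearMap.range L)
  have hindex : H.index = Fintype.card A := by
    rw [Subgroup.index, Nat.card_eq_fintype_card]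
  simp only [Module.finrank_prod, Module.finrank_fintype_fun_eq_card, Fintype.card_sum, V,
    Fintype.card_fin, Fintype.card_subtype_compl, Fintype.card_subtype_eq,
    Nat.card_eq_fintype_card] at *
  have hpos : 0 < Fintype.card A := Fintype.card_pos_iff.2 ⟨o⟩
  have cQz' : n * Fintype.card Qz ≤ Fintype.card A := cQz
  have hsum : Fintype.card A + 1 ≤
      m + (Fintype.card Qx + (Fintype.card Qy + Fintype.card Qz)) := by
    have := hrn.symm.trans_le (Nat.add_le_add hr hdim)
    omega
  rw [hindex]
  nlinarith [Nat.mul_le_mul_left n hsum, Nat.mul_le_mul_left n cQx, Nat.mul_le_mul_left n cQy]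

section ElementaryMatrices

variable {R : Type*} [CommRing R]

/-- The matrix `((1,c),(0,1))`. -/
def slUpper (c : R) : SpecialLinearGroup (Fin 2) R :=
  ⟨!![1, c; 0, 1], by simp [det_fin_two_of]⟩

/-- The matrix `((1,0),(c,1))`. -/
def slLower (c : R) : SpecialLinearGroup (Fin 2) R :=
  ⟨!![1, 0; c, 1], by simp [det_fin_two_of]⟩

theorem coe_slUpper (c : R) : (slUpper c : Matrix (Fin 2) (Fin 2) R) = !![1, c; 0, 1] := rfl

theorem coe_slLower (c : R) : (slLower c : Matrix (Fin 2) (Fin 2) R) = !![1, 0; c, 1] := rfl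

theorem slUpper_add (a b : R) : slUpper (a + b) = slUpper a * slUpper b := by
  ext i j
  fin_cases i <;> fin_cases j <;> simp [coe_slUpper, mul_apply, add_comm]

theorem slLower_add (a b : R) : slLower (a + b) = slLower a * slLower b := by
  ext i j
  fin_cases i <;> fin_cases j <;> simp [coe_slLower, mul_apply]

theorem slUpper_zpow (c : R) (m : ℤ) : slUpper c ^ m = slUpper (m * c) := by
  let f : Multiplicative R →* SpecialLinearGroup (Fin 2) R :=
    MonoidHom.mk' (fun c => slUpper c.toAdd) fun a b => slUpper_add _ _
  have := map_zpow f (Multiplicative.ofAdd c) m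
  rw [← ofAdd_zsmul, zsmul_eq_mul] at this
  exact this.symm

theorem slLower_zpow (c : R) (m : ℤ) : slLower c ^ m = slLower (m * c) := by
  let f : Multiplicative R →* SpecialLinearGroup (Fin 2) R :=
    MonoidHom.mk' (fun c => slLower c.toAdd) fun a b => slLower_add _ _
  have := map_zpow f (Multiplicative.ofAdd c) m
  rw [← ofAdd_zsmul, zsmul_eq_mul] at this
  exact this.symm

theorem slUpper_mul_slLower_mul_slUpper (M : SpecialLinearGroup (Fin 2) R) {e : R}
    (he : e * M 1 0 = 1) :
    M = slUpper ((M 0 0 - 1) * e) * slLower (M 1 0) * slUpper ((M 1 1 - 1) * e) := by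
  have hdet := M.det_coe
  rw [det_fin_two] at hdet
  ext i j
  fin_cases i <;> fin_cases j <;> simp [coe_slUpper, coe_slLower, mul_apply, Fin.sum_univ_two]
  · linear_combination (-(M 0 0 - 1)) * he
  · linear_combination (-(M 0 0 - 1) * (M 1 1 - 1) * e - M 0 1) * he - e * hdet
  · linear_combination (-(M 1 1 - 1)) * he

end ElementaryMatrices

theorem coe_slU (n : ℕ) : (slU n : Matrix (Fin 2) (Fin 2) (ZMod n)) = !![1, -1; 1, 0] := rfl

theorem coe_slV (n : ℕ) : (slV n : Matrix (Fin 2) (Fin 2) (ZMod n)) = !![0, -1; 1, 0] := rfl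

theorem closure_slUpper_one_slLower_one (n : ℕ) [NeZero n] :
    Subgroup.closure {slUpper (1 : ZMod n), slLower 1} = ⊤ := by
  set P := Subgroup.closure {slUpper (1 : ZMod n), slLower 1}
  have hU : ∀ c : ZMod n, slUpper c ∈ P := fun c => by
    have := P.zpow_mem (Subgroup.subset_closure (Or.inl rfl) : slUpper (1 : ZMod n) ∈ P) (c.val : ℤ)
    simpa [slUpper_zpow] using this
  have hL : ∀ c : ZMod n, slLower c ∈ P := fun c => by
    have := P.zpow_mem (Subgroup.subset_closure (Or.inr rfl) : slLower (1 : ZMod n) ∈ P) (c.val : ℤ)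
    simpa [slLower_zpow] using this
  have hunit : ∀ M : SpecialLinearGroup (Fin 2) (ZMod n), ∀ e, e * M 1 0 = 1 → M ∈ P := by
    intro M e he
    rw [slUpper_mul_slLower_mul_slUpper M he]
    exact P.mul_mem (P.mul_mem (hU _) (hL _)) (hU _)
  have hV : slV n ∈ P := hunit _ 1 (by simp [coe_slV])
  rw [Subgroup.eq_top_iff']
  intro M
  induction hN : (M 1 0).val using Nat.strong_induction_on generalizing M with
  | _ N ih =>
    by_cases hc : M 1 0 = 0
    · have hdet := M.det_coe
      rw [det_fin_two, hc, mul_zero, sub_zero] at hdet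
      refine (P.mul_mem_cancel_right (hL 1)).1 (hunit _ (M 0 0) ?_)
      simp [coe_slLower, mul_apply, hc, hdet]
    · have hpos : 0 < (M 1 0).val := by
        rw [Nat.pos_iff_ne_zero, Ne, ZMod.val_eq_zero]
        exact hc
      set t : ℕ := (M 1 1).val / (M 1 0).val
      refine (P.mul_mem_cancel_right (P.mul_mem (hU (-t)) hV)).1 (ih _ ?_ _ rfl)
      have h1 : (M * (slUpper (-(t : ZMod n)) * slV n)) 1 0 =
          (((M 1 1).val % (M 1 0).val : ℕ) : ZMod n) := by
        have h2 : (((M 1 0).val * t + (M 1 1).val % (M 1 0).val : ℕ) : ZMod n) = M 1 1 := by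
          rw [Nat.div_add_mod]
          simp
        push_cast at h2
        simp only [ZMod.natCast_val, ZMod.cast_id', id_eq] at h2
        simp [coe_slUpper, coe_slV, mul_apply, Fin.sum_univ_two]
        linear_combination -h2
      rw [h1, ZMod.val_natCast, ← hN]
      exact (Nat.mod_le _ _).trans_lt (Nat.mod_lt _ hpos)

theorem pslMk_eq_one_iff {n : ℕ} {M : SpecialLinearGroup (Fin 2) (ZMod n)} :
    pslMk n M = 1 ↔ M 0 1 = 0 ∧ M 1 0 = 0 ∧ M 0 0 = M 1 1 := by
  rw [pslMk, QuotientGroup.mk'_apply, QuotientGroup.eq_one_iff,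
    Matrix.SpecialLinearGroup.mem_center_iff]
  constructor
  · rintro ⟨r, -, hr⟩
    rw [← hr]
    simp
  · rintro ⟨h1, h2, h3⟩
    have hdet := M.det_coe
    rw [det_fin_two, h1, h2, h3] at hdet
    refine ⟨M 1 1, by simpa [pow_two] using hdet, ?_⟩
    ext i j
    fin_cases i <;> fin_cases j <;> simp [h1, h2, h3]

theorem pslMk_neg {n : ℕ} (M : SpecialLinearGroup (Fin 2) (ZMod n)) :
    pslMk n (-M) = pslMk n M := by
  have h : pslMk n (-1) = 1 := pslMk_eq_one_iff.2 (by simp)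
  rw [← neg_one_mul, map_mul, h, one_mul]

theorem slV_mul_slU (n : ℕ) : slV n * slU n = -slLower (-1) := by
  ext i j
  fin_cases i <;> fin_cases j <;> simp [coe_slU, coe_slV, coe_slLower, mul_apply]

theorem slU_mul_slV (n : ℕ) : slU n * slV n = -slUpper 1 := by
  ext i j
  fin_cases i <;> fin_cases j <;> simp [coe_slU, coe_slV, coe_slUpper, mul_apply]

theorem triangleRels_psl (n : ℕ) : ∀ r ∈ triangleRels 2 3 n,
    FreeGroup.lift ![pslMk n (slV n), pslMk n (slU n)] r = 1 := by
  simp only [triangleRels, Set.mem_insert_iff, Set.mem_singleton_iff, forall_eq_or_imp, forall_eq,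
    map_pow, map_mul, FreeGroup.lift_apply_of, cons_val_zero, cons_val_one]
  refine ⟨?_, ?_, ?_⟩
  · rw [← map_pow, pslMk_eq_one_iff]
    simp [coe_slV, pow_two, mul_apply]
  · rw [← map_pow, pslMk_eq_one_iff]
    simp [coe_slU, pow_succ, mul_apply]
  · rw [← map_mul, slV_mul_slU, pslMk_neg, ← map_pow, ← zpow_natCast, slLower_zpow,
      pslMk_eq_one_iff]
    simp [coe_slLower]

/-- The homomorphism from the `(2,3,n)` triangle group to `PSL(2, ℤ/nℤ)`. -/
def triangleToPSL (n : ℕ) : Triangle 2 3 n →* PSLZ n :=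
  PresentedGroup.toGroup (triangleRels_psl n)

theorem triangleToPSL_of_zero (n : ℕ) :
    triangleToPSL n (PresentedGroup.of 0) = pslMk n (slV n) :=
  PresentedGroup.toGroup.of (triangleRels_psl n)

theorem triangleToPSL_of_one (n : ℕ) :
    triangleToPSL n (PresentedGroup.of 1) = pslMk n (slU n) :=
  PresentedGroup.toGroup.of (triangleRels_psl n)

theorem triangleToPSL_xy (n : ℕ) :
    triangleToPSL n (PresentedGroup.of 0 * PresentedGroup.of 1) = pslMk n (slLower (-1)) := by
  rw [map_mul, triangleToPSL_of_zero, triangleToPSL_of_one, ← map_mul, slV_mul_slU, pslMk_neg]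

theorem triangleToPSL_yx (n : ℕ) :
    triangleToPSL n (PresentedGroup.of 1 * PresentedGroup.of 0) = pslMk n (slUpper 1) := by
  rw [map_mul, triangleToPSL_of_zero, triangleToPSL_of_one, ← map_mul, slU_mul_slV, pslMk_neg]

theorem triangleToPSL_surjective (n : ℕ) [NeZero n] : Function.Surjective (triangleToPSL n) := by
  rw [← MonoidHom.range_eq_top, eq_top_iff]
  have h : (⊤ : Subgroup (PSLZ n)) = (⊤ : Subgroup _).map (pslMk n) :=
    (Subgroup.map_top_of_surjective _ (QuotientGroup.mk'_surjective _)).symm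
  rw [h, ← closure_slUpper_one_slLower_one, MonoidHom.map_closure, Subgroup.closure_le]
  rintro _ ⟨_, rfl | rfl, rfl⟩
  · exact ⟨_, triangleToPSL_yx n⟩
  · refine ⟨(PresentedGroup.of 0 * PresentedGroup.of 1)⁻¹, ?_⟩
    rw [map_inv, triangleToPSL_xy, ← map_inv, ← _root_.zpow_neg_one, slLower_zpow]
    simp

theorem triangleToPSL_of_zero_ne_one {n : ℕ} (hn : 1 < n) :
    triangleToPSL n (PresentedGroup.of 0) ≠ 1 := by
  have : Fact (1 < n) := ⟨hn⟩
  rw [triangleToPSL_of_zero, Ne, pslMk_eq_one_iff]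
  simp [coe_slV]

theorem triangleToPSL_of_one_ne_one {n : ℕ} (hn : 1 < n) :
    triangleToPSL n (PresentedGroup.of 1) ≠ 1 := by
  have : Fact (1 < n) := ⟨hn⟩
  rw [triangleToPSL_of_one, Ne, pslMk_eq_one_iff]
  simp [coe_slU]

theorem triangleToPSL_xy_pow_ne_one {n i : ℕ} (h0 : 0 < i) (hi : i < n) :
    triangleToPSL n ((PresentedGroup.of 0 * PresentedGroup.of 1) ^ i) ≠ 1 := by
  rw [map_pow, triangleToPSL_xy, ← map_pow, ← zpow_natCast, slLower_zpow, Ne, pslMk_eq_one_iff]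
  rintro ⟨-, h, -⟩
  have : ((i : ℕ) : ZMod n) = 0 := by simpa [coe_slLower] using h
  rw [ZMod.natCast_eq_zero_iff] at this
  exact absurd (Nat.le_of_dvd h0 this) (by omega)

theorem pslMk_slUpper_slLower_words {n k : ℕ} (hn : n = 2 * k + 1) :
    (let A := pslMk n (slUpper 2); let B := pslMk n (slLower (-2))
     A ^ k * B ^ k * A ^ ((k : ℤ) - (k : ℤ) ^ 2) * B⁻¹ * A ^ k *
      B⁻¹ * A ^ ((k : ℤ) - (k : ℤ) ^ 2) * B ^ k * A ^ k = 1) ∧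
    (let A := pslMk n (slUpper 2); let B := pslMk n (slLower (-2))
     A ^ k * B ^ k * A ^ ((k : ℤ) - (k : ℤ) ^ 2) * B⁻¹ * A ^ (k + 1) *
      B * A ^ ((k : ℤ) + (k : ℤ) ^ 2) * B ^ k * A ^ (5 * k) = 1) := by
  have h : 2 * (k : ZMod n) + 1 = 0 := by
    have h : ((2 * k + 1 : ℕ) : ZMod n) = 0 := by rw [← hn, ZMod.natCast_self]
    exact_mod_cast h
  have e0 : (k : ZMod n) * 2 = -1 := by linear_combination h
  have e1 : ((k : ZMod n) - k ^ 2) * 2 = k - 1 := by linear_combination (1 - (k : ZMod n)) * h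
  have e2 : ((k : ZMod n) + k ^ 2) * 2 = -1 - k := by linear_combination (1 + (k : ZMod n)) * h
  have e3 : ((k : ZMod n) + 1) * 2 = 1 := by linear_combination h
  have e4 : (5 * (k : ZMod n)) * 2 = -5 := by linear_combination 5 * h
  have e5 : (k : ZMod n) * -2 = 1 := by linear_combination -h
  simp only [← map_pow, ← map_mul, ← map_inv, ← map_zpow]
  simp only [← zpow_natCast, ← _root_.zpow_neg_one (slLower _), slUpper_zpow, slLower_zpow]
  push_cast
  simp only [e0, e1, e2, e3, e4, e5]
  constructor
  · rw [pslMk_eq_one_iff]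
    simp only [Matrix.SpecialLinearGroup.coe_mul, coe_slUpper, coe_slLower, mul_fin_two, of_apply,
      cons_val', cons_val_zero, cons_val_one, cons_val_fin_one]
    refine ⟨?_, ?_, ?_⟩
    · ring
    · linear_combination -h
    · ring
  · rw [pslMk_eq_one_iff]
    simp only [Matrix.SpecialLinearGroup.coe_mul, coe_slUpper, coe_slLower, mul_fin_two, of_apply,
      cons_val', cons_val_zero, cons_val_one, cons_val_fin_one]
    refine ⟨?_, ?_, ?_⟩
    · linear_combination 8 * h
    · linear_combination (1 + 2 * (k : ZMod n)) * h
    · linear_combination (-2 + 2 + 8 * (k : ZMod n)) * h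

namespace CoxeterSystem

variable {B W V : Type*} [Group W] {M : CoxeterMatrix B} (cs : CoxeterSystem M W)
  [AddCommGroup V] [Module ℝ V] {β : B → V} {σ : W →* Module.End ℝ V}

/-- In a rank two reflection representation, an alternating word acts on a simple root through the
Chebyshev-type sequence `p` attached to the entry of the Coxeter matrix. -/
theorem map_wordProd_alternatingWord_apply
    (hσ : ∀ i j, σ (cs.simple i) (β j) = β j + (2 * Real.cos (Real.pi / M i j)) • β i)
    (s t : B) {p : ℕ → ℝ} (p0 : p 0 = 0) (p1 : p 1 = 1)
    (hp : ∀ a, p (a + 2) = 2 * Real.cos (Real.pi / M s t) * p (a + 1) - p a) (j : ℕ) :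
    σ (cs.wordProd (alternatingWord s t j)) (β s) =
      if Even j then p (j + 1) • β s + p j • β t else p j • β s + p (j + 1) • β t := by
  have hs : ∀ i, σ (cs.simple i) (β i) = -β i := fun i => by
    rw [hσ, M.diagonal]
    norm_num
    module
  induction j with
  | zero => simp [p0, p1, alternatingWord]
  | succ j ih =>
    rw [alternatingWord_succ', cs.wordProd_cons, map_mul, Module.End.mul_apply, ih]
    by_cases h : Even j
    · simp only [h, if_true, Nat.even_add_one, not_true, if_false, map_add, map_smul, hs,
        hσ t s, M.symmetric t s, hp]
      module
    · simp only [h, if_false, Nat.even_add_one, not_false_eq_true, if_true, map_add, map_smul, hs,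
        hσ s t, hp]
      module

/-- If `s` is not a right descent of `w` but `t` is, then `w` factors, with additive lengths,
through a proper alternating word in `s` and `t`. -/
theorem exists_eq_mul_wordProd_alternatingWord {w : W} {s t : B} (hM : M s t ≠ 0)
    (hs : ¬ cs.IsRightDescent w s) (ht : cs.IsRightDescent w t) :
    ∃ v j, w = v * cs.wordProd (alternatingWord s t j) ∧ cs.length v < cs.length w ∧ j < M s t ∧
      ¬ cs.IsRightDescent v s ∧ ¬ cs.IsRightDescent v t := by
  classical
  let P : ℕ → Prop := fun j =>
    ∃ v, w = v * cs.wordProd (alternatingWord s t j) ∧ cs.length w = cs.length v + j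
  have hP : P 1 := ⟨w * cs.simple t, by simp [alternatingWord],
    ((cs.isRightDescent_iff).1 ht).symm⟩
  have hw : 1 ≤ cs.length w := by have := (cs.isRightDescent_iff).1 ht; omega
  set j := Nat.findGreatest P (cs.length w) with hj
  obtain ⟨v, hv, hl⟩ : P j := Nat.findGreatest_spec hw hP
  have h1 : 1 ≤ j := Nat.le_findGreatest hw hP
  have hmax : ¬ P (j + 1) := fun h => by
    have : j + 1 ≤ cs.length w := by obtain ⟨u, -, hu⟩ := h; omega
    have := Nat.le_findGreatest this h
    omega
  have hlen : ∀ a b (m : ℕ), cs.length (cs.wordProd (alternatingWord a b m)) ≤ m := fun a b m => by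
    simpa using cs.length_wordProd_le (alternatingWord a b m)
  have hnext : ¬ cs.IsRightDescent v (if Even j then t else s) := fun h => hmax
    ⟨v * cs.simple (if Even j then t else s), by
      rw [alternatingWord_succ', cs.wordProd_cons, mul_assoc, cs.simple_mul_simple_cancel_left, hv],
      by have := (cs.isRightDescent_iff).1 h; omega⟩
  obtain ⟨i, hi⟩ : ∃ i, j = i + 1 := ⟨j - 1, by omega⟩
  have hfirst : ¬ cs.IsRightDescent v (if Even i then t else s) := fun h => by
    have h2 := (cs.isRightDescent_iff).1 h
    rw [hi, alternatingWord_succ', cs.wordProd_cons, ← mul_assoc] at hv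
    have h3 := cs.length_mul_le (v * cs.simple (if Even i then t else s))
      (cs.wordProd (alternatingWord s t i))
    rw [← hv] at h3
    have := hlen s t i
    omega
  refine ⟨v, j, hv, by omega, ?_, ?_⟩
  · have hle : j ≤ M s t := by
      by_contra h
      refine cs.not_isReduced_alternatingWord s t hM (not_le.1 h) ?_
      have h3 := cs.length_mul_le v (cs.wordProd (alternatingWord s t j))
      rw [← hv] at h3
      have := hlen s t j
      rw [IsReduced, length_alternatingWord]
      omega
    refine lt_of_le_of_ne hle fun h => hs ?_
    rw [cs.prod_alternatingWord_eq_prod_alternatingWord_sub s t j (by omega),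
      show M s t * 2 - j = i + 1 by omega, alternatingWord_succ, cs.wordProd_concat] at hv
    have h4 : w * cs.simple s = v * cs.wordProd (alternatingWord s t i) := by
      rw [hv, mul_assoc, mul_assoc, cs.simple_mul_simple_self, mul_one]
    have h3 := cs.length_mul_le v (cs.wordProd (alternatingWord s t i))
    have := hlen s t i
    rw [IsRightDescent, h4]
    omega
  · rw [hi] at hnext
    by_cases h : Even i
    · simp only [Nat.even_add_one, h, not_true, if_true, if_false] at hnext hfirst
      exact ⟨hnext, hfirst⟩
    · simp only [Nat.even_add_one, h, not_false_eq_true, if_true, if_false] at hnext hfirst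
      exact ⟨hfirst, hnext⟩

/-- In a reflection representation, `w` maps the simple root of `s` to a nonnegative combination of
simple roots unless `s` is a right descent of `w`. -/
theorem exists_map_apply_eq_sum_nonneg [Fintype B] (hM : ∀ i j, M i j ≠ 0)
    (hσ : ∀ i j, σ (cs.simple i) (β j) = β j + (2 * Real.cos (Real.pi / M i j)) • β i)
    (w : W) (s : B) (hs : ¬ cs.IsRightDescent w s) :
    ∃ c : B → ℝ, (∀ i, 0 ≤ c i) ∧ σ w (β s) = ∑ i, c i • β i := by
  classical
  induction h : cs.length w using Nat.strong_induction_on generalizing w s with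
  | _ N ih =>
  by_cases hw : w = 1
  · refine ⟨Pi.single s 1, fun i => ?_, ?_⟩
    · by_cases h : i = s <;> simp [h]
    · simp [hw, Pi.single_apply]
  obtain ⟨t, ht⟩ := cs.exists_rightDescent_of_ne_one hw
  have hst : s ≠ t := fun h => hs (h ▸ ht)
  obtain ⟨v, j, hv, hl, hj, hvs, hvt⟩ := cs.exists_eq_mul_wordProd_alternatingWord (hM s t) hs ht
  obtain ⟨cs', hcs, es⟩ := ih _ (h ▸ hl) v s hvs rfl
  obtain ⟨ct, hct, et⟩ := ih _ (h ▸ hl) v t hvt rfl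
  set θ := Real.pi / M s t with hθ
  have hm : 2 ≤ M s t := by
    have := M.off_diagonal s t hst
    have := hM s t
    omega
  have hm0 : (0 : ℝ) < M s t := by exact_mod_cast (by omega : 0 < M s t)
  have hnn : ∀ a : ℕ, a ≤ M s t → 0 ≤ Real.sin (a * θ) := fun a ha => by
    refine Real.sin_nonneg_of_nonneg_of_le_pi (by positivity) ?_
    calc (a : ℝ) * θ ≤ M s t * θ := by gcongr
      _ = Real.pi := by rw [hθ]; field_simp
  have hpos : 0 < Real.sin θ := by
    refine Real.sin_pos_of_pos_of_lt_pi (by positivity) ?_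
    rw [hθ, div_lt_iff₀ hm0]
    have : (2 : ℝ) ≤ M s t := by exact_mod_cast hm
    nlinarith [Real.pi_pos]
  have key := cs.map_wordProd_alternatingWord_apply hσ s t
    (p := fun a => Real.sin (a * θ) / Real.sin θ)
    (by simp) (by simp [hpos.ne']) (fun a => by
      rw [← hθ]
      have h1 : ((a + 2 : ℕ) : ℝ) * θ = (a + 1 : ℕ) * θ + θ := by push_cast; ring
      have h2 : (a : ℝ) * θ = (a + 1 : ℕ) * θ - θ := by push_cast; ring
      simp only [h1, h2, Real.sin_add, Real.sin_sub]
      ring) j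
  have h1 := div_nonneg (hnn j hj.le) hpos.le
  have h2 := div_nonneg (hnn (j + 1) hj) hpos.le
  rw [hv, map_mul, Module.End.mul_apply, key]
  split_ifs
  · refine ⟨fun i => Real.sin ((j + 1 : ℕ) * θ) / Real.sin θ * cs' i +
      Real.sin (j * θ) / Real.sin θ * ct i, fun i => ?_, ?_⟩
    · exact add_nonneg (mul_nonneg h2 (hcs i)) (mul_nonneg h1 (hct i))
    · simp only [map_add, map_smul, es, et, Finset.smul_sum, ← Finset.sum_add_distrib, smul_smul,
        add_smul]
  · refine ⟨fun i => Real.sin (j * θ) / Real.sin θ * cs' i +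
      Real.sin ((j + 1 : ℕ) * θ) / Real.sin θ * ct i, fun i => ?_, ?_⟩
    · exact add_nonneg (mul_nonneg h1 (hcs i)) (mul_nonneg h2 (hct i))
    · simp only [map_add, map_smul, es, et, Finset.smul_sum, ← Finset.sum_add_distrib, smul_smul,
        add_smul]

/-- **Tits' theorem**: the reflection representation of a Coxeter group is faithful. -/
theorem eq_one_of_map_apply_eq_self [Fintype B] (hM : ∀ i j, M i j ≠ 0)
    (hβ : LinearIndependent ℝ β)
    (hσ : ∀ i j, σ (cs.simple i) (β j) = β j + (2 * Real.cos (Real.pi / M i j)) • β i)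
    {w : W} (hw : ∀ j, σ w (β j) = β j) : w = 1 := by
  classical
  by_contra h
  obtain ⟨s, hs⟩ := cs.exists_rightDescent_of_ne_one h
  obtain ⟨c, hc, e⟩ := cs.exists_map_apply_eq_sum_nonneg hM hσ (w * cs.simple s) s
    ((cs.isRightDescent_iff_not_isRightDescent_mul).1 hs)
  have h1 : σ (cs.simple s) (β s) = -β s := by
    rw [hσ, M.diagonal]
    norm_num
    module
  rw [map_mul, Module.End.mul_apply, h1, map_neg, hw] at e
  have h2 : ∑ i, (c i + Pi.single (M := fun _ => ℝ) s 1 i) • β i = 0 := by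
    simp [add_smul, Finset.sum_add_distrib, ← e, Pi.single_apply]
  have h3 := Fintype.linearIndependent_iff.1 hβ _ h2 s
  have := hc s
  simp at h3
  linarith

end CoxeterSystem

/-- The Coxeter matrix of the full triangle group of type `(l, m, n)`. -/
def CoxeterMatrix.triangle (l m n : ℕ) (hl : l ≠ 1) (hm : m ≠ 1) (hn : n ≠ 1) :
    CoxeterMatrix (Fin 3) where
  M := !![1, l, n; l, 1, m; n, m, 1]
  isSymm := by
    ext i j
    fin_cases i <;> fin_cases j <;> rfl
  diagonal i := by fin_cases i <;> rfl
  off_diagonal i j h := by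
    fin_cases i <;> fin_cases j <;> first | exact absurd rfl h | assumption

theorem mul_pow_eq_one_of_mul_eq_one {G : Type*} [Monoid G] {a b c : G} (hb : b * c = 1) {m : ℕ}
    (h : (a * b) ^ m = 1) : (b * a) ^ m = 1 :=
  calc (b * a) ^ m = (b * a) ^ m * b * c := by rw [mul_assoc, hb, mul_one]
    _ = 1 := by rw [mul_pow_mul, h, mul_one, hb]

theorem CoxeterMatrix.isLiftable_triangle {G : Type*} [Monoid G] {l m n : ℕ} (hl : l ≠ 1)
    (hm : m ≠ 1) (hn : n ≠ 1) {f : Fin 3 → G} (h : ∀ i, f i * f i = 1)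
    (h01 : (f 0 * f 1) ^ l = 1) (h12 : (f 1 * f 2) ^ m = 1) (h02 : (f 0 * f 2) ^ n = 1) :
    (triangle l m n hl hm hn).IsLiftable f := by
  have h10 := mul_pow_eq_one_of_mul_eq_one (h 1) h01
  have h21 := mul_pow_eq_one_of_mul_eq_one (h 2) h12
  have h20 := mul_pow_eq_one_of_mul_eq_one (h 2) h02
  intro i j
  fin_cases i <;> fin_cases j <;> first | assumption | exact (pow_one _).trans (h _)

namespace Triangle

variable {l m n : ℕ}

/-- The automorphism of the triangle group inverting both generators. -/
def invGens (l m n : ℕ) : Triangle l m n →* Triangle l m n :=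
  PresentedGroup.toGroup (f := fun i => (PresentedGroup.of i)⁻¹) <| by
    rintro r (rfl | rfl | rfl)
    · simp [of_zero_pow]
    · simp [of_one_pow]
    · rw [map_pow, map_mul, FreeGroup.lift_apply_of, FreeGroup.lift_apply_of, ← _root_.mul_inv_rev,
        inv_pow, inv_eq_one]
      exact mul_pow_eq_one_of_mul_eq_one (mul_inv_cancel _) (mul_pow l m n)

theorem invGens_of (i : Fin 2) :
    invGens l m n (PresentedGroup.of i) = (PresentedGroup.of i)⁻¹ :=
  PresentedGroup.toGroup.of _

theorem invGens_invGens (g : Triangle l m n) : invGens l m n (invGens l m n g) = g := by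
  suffices (invGens l m n).comp (invGens l m n) = MonoidHom.id _ from DFunLike.congr_fun this g
  refine PresentedGroup.ext fun i => ?_
  simp [invGens_of]

variable (hl : l ≠ 1) (hm : m ≠ 1) (hn : n ≠ 1)

/-- The embedding of the triangle group into the full triangle group. -/
def toCoxeter : Triangle l m n →* (CoxeterMatrix.triangle l m n hl hm hn).Group :=
  letI cs := (CoxeterMatrix.triangle l m n hl hm hn).toCoxeterSystem
  PresentedGroup.toGroup
    (f := ![cs.simple 0 * cs.simple 1, cs.simple 1 * cs.simple 2]) <| by
    rintro r (rfl | rfl | rfl)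
    · rw [map_pow, FreeGroup.lift_apply_of]
      exact cs.simple_mul_simple_pow 0 1
    · rw [map_pow, FreeGroup.lift_apply_of]
      exact cs.simple_mul_simple_pow 1 2
    · rw [map_pow, map_mul, FreeGroup.lift_apply_of, FreeGroup.lift_apply_of]
      change (cs.simple 0 * cs.simple 1 * (cs.simple 1 * cs.simple 2)) ^ n = 1
      rw [mul_assoc, cs.simple_mul_simple_cancel_left]
      exact cs.simple_mul_simple_pow 0 2

theorem toCoxeter_of_zero : toCoxeter hl hm hn (PresentedGroup.of 0) =
    (CoxeterMatrix.triangle l m n hl hm hn).toCoxeterSystem.simple 0 *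
      (CoxeterMatrix.triangle l m n hl hm hn).toCoxeterSystem.simple 1 :=
  PresentedGroup.toGroup.of _

theorem toCoxeter_of_one : toCoxeter hl hm hn (PresentedGroup.of 1) =
    (CoxeterMatrix.triangle l m n hl hm hn).toCoxeterSystem.simple 1 *
      (CoxeterMatrix.triangle l m n hl hm hn).toCoxeterSystem.simple 2 :=
  PresentedGroup.toGroup.of _

theorem toCoxeter_injective : Function.Injective (toCoxeter hl hm hn) := by
  let L : Triangle l m n →* Equiv.Perm (Triangle l m n) := MulAction.toPermHom _ _
  let τ : Equiv.Perm (Triangle l m n) := Function.Involutive.toPerm (invGens l m n) invGens_invGens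
  let x : Triangle l m n := PresentedGroup.of 0
  let y : Triangle l m n := PresentedGroup.of 1
  have hτ : τ * τ = 1 := Equiv.ext invGens_invGens
  have hx : τ * L x * τ = L x⁻¹ := Equiv.ext fun g => by
    change invGens l m n (x * invGens l m n g) = x⁻¹ * g
    rw [map_mul, invGens_invGens, invGens_of]
  have hy : τ * L y * τ = L y⁻¹ := Equiv.ext fun g => by
    change invGens l m n (y * invGens l m n g) = y⁻¹ * g
    rw [map_mul, invGens_invGens, invGens_of]
  have h01 : L x * τ * τ = L x := by rw [mul_assoc, hτ, mul_one]
  have h12 : τ * (τ * L y) = L y := by rw [← mul_assoc, hτ, one_mul]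
  let f : Fin 3 → Equiv.Perm (Triangle l m n) := ![L x * τ, τ, τ * L y]
  have hf : (CoxeterMatrix.triangle l m n hl hm hn).IsLiftable f := by
    refine CoxeterMatrix.isLiftable_triangle hl hm hn (fun i => ?_) ?_ ?_ ?_
    · fin_cases i
      · change L x * τ * (L x * τ) = 1
        rw [mul_assoc, ← mul_assoc τ, hx, ← map_mul, mul_inv_cancel, map_one]
      · exact hτ
      · change τ * L y * (τ * L y) = 1
        rw [← mul_assoc, hy, ← map_mul, inv_mul_cancel, map_one]
    · change (L x * τ * τ) ^ l = 1
      rw [h01, ← map_pow, of_zero_pow, map_one]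
    · change (τ * (τ * L y)) ^ m = 1
      rw [h12, ← map_pow, of_one_pow, map_one]
    · change (L x * τ * (τ * L y)) ^ n = 1
      rw [mul_assoc, h12, ← map_mul, ← map_pow, mul_pow, map_one]
  let cs := (CoxeterMatrix.triangle l m n hl hm hn).toCoxeterSystem
  have h : (cs.lift ⟨f, hf⟩).comp (toCoxeter hl hm hn) = L := by
    refine PresentedGroup.ext fun i => ?_
    fin_cases i
    · change cs.lift ⟨f, hf⟩ (toCoxeter hl hm hn x) = L x
      rw [toCoxeter_of_zero, map_mul, cs.lift_apply_simple, cs.lift_apply_simple]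
      exact h01
    · change cs.lift ⟨f, hf⟩ (toCoxeter hl hm hn y) = L y
      rw [toCoxeter_of_one, map_mul, cs.lift_apply_simple, cs.lift_apply_simple]
      exact h12
  have hL : Function.Injective L := MulAction.toPerm_injective
  rw [← h, MonoidHom.coe_comp] at hL
  exact hL.of_comp

end Triangle

section Conjugation

variable {d : ℂ} {a b : Matrix (Fin 2) (Fin 2) ℂ}

/-- The action of `GL(2, ℂ)` by conjugation on two by two matrices, seen as a real vector space. -/
noncomputable def conjEnd : GL (Fin 2) ℂ →* Module.End ℝ (Matrix (Fin 2) (Fin 2) ℂ) where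
  toFun g := LinearMap.mulLeft ℝ (g : Matrix (Fin 2) (Fin 2) ℂ) *
    LinearMap.mulRight ℝ ((g⁻¹ : GL (Fin 2) ℂ) : Matrix (Fin 2) (Fin 2) ℂ)
  map_one' := by ext1 v; simp
  map_mul' g h := by
    ext1 v
    simp only [Module.End.mul_apply, LinearMap.mulLeft_apply, LinearMap.mulRight_apply,
      _root_.mul_inv_rev, Units.val_mul, mul_assoc]

theorem conjEnd_apply (g : GL (Fin 2) ℂ) (v : Matrix (Fin 2) (Fin 2) ℂ) :
    conjEnd g v = g * (v * ((g⁻¹ : GL (Fin 2) ℂ) : Matrix (Fin 2) (Fin 2) ℂ)) := rfl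

theorem conjEnd_eq_one_of_mem_center {g : GL (Fin 2) ℂ}
    (hg : g ∈ Subgroup.center (GL (Fin 2) ℂ)) : conjEnd g = 1 := by
  obtain ⟨c, hc⟩ := GeneralLinearGroup.mem_center_iff_val_mem_range_scalar.1 hg
  ext1 v
  rw [conjEnd_apply, ← mul_assoc, ← hc, (scalar_commute c (fun r' => Commute.all _ _) v).eq, hc,
    mul_assoc, Units.mul_inv, mul_one, Module.End.one_apply]

/-- For `a ^ 2 = d`, the orthogonal reflection in `a` on two by two matrices. -/
noncomputable def matrixReflection (d : ℂ) (a : Matrix (Fin 2) (Fin 2) ℂ) :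
    Module.End ℝ (Matrix (Fin 2) (Fin 2) ℂ) :=
  (-d⁻¹) • (LinearMap.mulLeft ℝ a * LinearMap.mulRight ℝ a)

theorem matrixReflection_apply (d : ℂ) (a v : Matrix (Fin 2) (Fin 2) ℂ) :
    matrixReflection d a v = (-d⁻¹) • (a * (v * a)) := rfl

theorem matrixReflection_mul_self (hd : d ≠ 0) (ha : a * a = d • 1) :
    matrixReflection d a * matrixReflection d a = 1 := by
  ext1 v
  rw [Module.End.mul_apply, matrixReflection_apply, matrixReflection_apply, smul_mul_assoc,
    mul_smul_comm, mul_assoc a, mul_assoc v, ha, mul_smul_comm, mul_one, mul_smul_comm,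
    mul_smul_comm, ← mul_assoc, ha, smul_mul_assoc, one_mul, smul_smul, smul_smul, smul_smul,
    Module.End.one_apply]
  field_simp
  simp

theorem matrixReflection_mul (hd : d ≠ 0) (ha : a * a = d • 1) (hb : b * b = d • 1) {c : ℂ}
    (hc : c ≠ 0) {g : GL (Fin 2) ℂ} (h : a * b = c • (g : Matrix (Fin 2) (Fin 2) ℂ)) :
    matrixReflection d a * matrixReflection d b = conjEnd g := by
  have h1 : b * a = (d * d / c) • ((g⁻¹ : GL (Fin 2) ℂ) : Matrix (Fin 2) (Fin 2) ℂ) := by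
    have h2 : b * a * (a * b) = (d * d) • (1 : Matrix (Fin 2) (Fin 2) ℂ) := by
      rw [mul_assoc, ← mul_assoc a, ha, smul_mul_assoc, one_mul, mul_smul_comm, hb, smul_smul]
    rw [h, mul_smul_comm] at h2
    have h3 := congrArg (fun m => c⁻¹ • (m * ((g⁻¹ : GL (Fin 2) ℂ) : Matrix (Fin 2) (Fin 2) ℂ))) h2
    simp only [smul_mul_assoc, mul_assoc, Units.mul_inv, one_mul, mul_one, smul_smul,
      inv_mul_cancel₀ hc, one_smul] at h3
    rw [h3]
    congr 1
    ring
  ext1 v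
  rw [Module.End.mul_apply, matrixReflection_apply, matrixReflection_apply, smul_mul_assoc,
    mul_smul_comm, mul_assoc b, mul_assoc v, h1, ← mul_assoc, h, smul_smul, conjEnd_apply,
    mul_smul_comm, smul_mul_assoc, mul_smul_comm, smul_smul, smul_smul]
  field_simp
  simp

theorem matrixReflection_apply_of_anticomm (hd : d ≠ 0) (ha : a * a = d • 1) {e : ℝ}
    (h : a * b + b * a = (-(e : ℂ) * d) • 1) : matrixReflection d a b = b + e • a := by
  have h1 : a * b = (-(e : ℂ) * d) • 1 - b * a := eq_sub_of_add_eq h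
  rw [matrixReflection_apply, ← mul_assoc, h1, sub_mul, mul_assoc b, ha, smul_mul_assoc, one_mul,
    mul_smul_comm, mul_one, smul_sub, smul_smul, smul_smul, ← Complex.coe_smul]
  field_simp
  module

end Conjugation

section Generators

variable {R : Type*} [CommRing R]

/-- The matrix `((0,1),(-q,0))`, whose class in `PGL(2)` has order two. -/
def burauX (q : Rˣ) : GL (Fin 2) R where
  val := !![0, 1; -q, 0]
  inv := !![0, -((q⁻¹ : Rˣ) : R); 1, 0]
  val_inv := by simp [one_fin_two]
  inv_val := by simp [one_fin_two]

/-- The matrix `((1,-1),(1,0))`, whose class in `PGL(2)` has order three. -/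
def burauY (R : Type*) [CommRing R] : GL (Fin 2) R where
  val := !![1, -1; 1, 0]
  inv := !![0, 1; -1, 1]
  val_inv := by simp [one_fin_two]
  inv_val := by simp [one_fin_two]

theorem coe_burauX (q : Rˣ) : (burauX q : Matrix (Fin 2) (Fin 2) R) = !![0, 1; -(q : R), 0] := rfl

theorem coe_burauY : (burauY R : Matrix (Fin 2) (Fin 2) R) = !![1, -1; 1, 0] := rfl

/-- The representation of the free group on two generators lifting the projective representation
of the triangle group attached to `q`. -/
def burau (q : Rˣ) : FreeGroup (Fin 2) →* GL (Fin 2) R := FreeGroup.lift ![burauX q, burauY R]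

theorem burau_of_zero (q : Rˣ) : burau q (FreeGroup.of 0) = burauX q := FreeGroup.lift_apply_of

theorem burau_of_one (q : Rˣ) : burau q (FreeGroup.of 1) = burauY R := FreeGroup.lift_apply_of

theorem map_burau {S : Type*} [CommRing S] (f : R →+* S) (q : Rˣ) (w : FreeGroup (Fin 2)) :
    GeneralLinearGroup.map f (burau q w) = burau (Units.map f q) w := by
  suffices (GeneralLinearGroup.map f).comp (burau q) = burau (Units.map f q) from
    DFunLike.congr_fun this w
  ext1 i
  fin_cases i
  · ext i j
    change f (burau q (FreeGroup.of 0) i j) = burau (Units.map f q) (FreeGroup.of 0) i j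
    rw [burau_of_zero, burau_of_zero, coe_burauX, coe_burauX]
    fin_cases i <;> fin_cases j <;> simp
  · ext i j
    change f (burau q (FreeGroup.of 1) i j) = burau (Units.map f q) (FreeGroup.of 1) i j
    rw [burau_of_one, burau_of_one, coe_burauY, coe_burauY]
    fin_cases i <;> fin_cases j <;> simp

theorem GeneralLinearGroup.mem_center_fin_two_iff {g : GL (Fin 2) R} :
    g ∈ Subgroup.center (GL (Fin 2) R) ↔ g 0 1 = 0 ∧ g 1 0 = 0 ∧ g 0 0 = g 1 1 := by
  rw [GeneralLinearGroup.mem_center_iff_val_mem_range_scalar]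
  constructor
  · rintro ⟨c, hc⟩
    simp [← hc]
  · rintro ⟨h1, h2, h3⟩
    refine ⟨g 0 0, ?_⟩
    ext i j
    fin_cases i <;> fin_cases j <;> simp [h1, h2, h3]

theorem GeneralLinearGroup.map_mem_center_iff {S : Type*} [CommRing S] {f : R →+* S}
    (hf : Function.Injective f) {g : GL (Fin 2) R} :
    GeneralLinearGroup.map f g ∈ Subgroup.center (GL (Fin 2) S) ↔
      g ∈ Subgroup.center (GL (Fin 2) R) := by
  simp only [GeneralLinearGroup.mem_center_fin_two_iff, GeneralLinearGroup.map_apply,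
    map_eq_zero_iff f hf, hf.eq_iff]

theorem burauX_mul_burauY (q : Rˣ) :
    ((burauX q * burauY R : GL (Fin 2) R) : Matrix (Fin 2) (Fin 2) R) =
      !![1, 0; -(q : R), (q : R)] := by
  simp [coe_burauX, coe_burauY]

theorem burauY_mul_burauX (q : Rˣ) :
    ((burauY R * burauX q : GL (Fin 2) R) : Matrix (Fin 2) (Fin 2) R) = !![(q : R), 1; 0, 1] := by
  simp [coe_burauX, coe_burauY]

theorem burauX_sq_mem_center (q : Rˣ) : burauX q ^ 2 ∈ Subgroup.center (GL (Fin 2) R) := by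
  simp [GeneralLinearGroup.mem_center_fin_two_iff, sq, coe_burauX]

theorem burauY_pow_three_mem_center : burauY R ^ 3 ∈ Subgroup.center (GL (Fin 2) R) := by
  simp [GeneralLinearGroup.mem_center_fin_two_iff, pow_succ, coe_burauY]

theorem coe_burauX_mul_burauY_pow (q : Rˣ) (m : ℕ) :
    (((burauX q * burauY R) ^ m : GL (Fin 2) R) : Matrix (Fin 2) (Fin 2) R) =
      !![1, 0; -(q * ∑ i ∈ Finset.range m, (q : R) ^ i), (q : R) ^ m] := by
  induction m with
  | zero => simp [one_fin_two]
  | succ m ih =>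
    rw [pow_succ, Units.val_mul, ih, burauX_mul_burauY, Finset.sum_range_succ, mul_fin_two]
    ext i j
    fin_cases i <;> fin_cases j <;> simp <;> ring

theorem burauX_mul_burauY_pow_mem_center [IsDomain R] {q : Rˣ} {n : ℕ}
    (hq : IsPrimitiveRoot (q : R) n) (hn : 1 < n) :
    (burauX q * burauY R) ^ n ∈ Subgroup.center (GL (Fin 2) R) := by
  rw [GeneralLinearGroup.mem_center_fin_two_iff, coe_burauX_mul_burauY_pow,
    hq.geom_sum_eq_zero hn, hq.pow_eq_one]
  simp

end Generators

namespace Triangle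

/-- The simple roots of the reflection representation of the full `(2, 3, n)` triangle group on two
by two matrices, in terms of a square root `r` of `q` and its inverse `s`. -/
def simpleRoot (r s : ℂ) : Fin 3 → Matrix (Fin 2) (Fin 2) ℂ :=
  ![!![-r, r - s; r ^ 3 - r, r], !![1 - r ^ 2, -1; -r ^ 2, r ^ 2 - 1],
    !![r ^ 2, 1 - r ^ 2; 1, -r ^ 2]]

variable {r s : ℂ}

theorem simpleRoot_mul_self (hrs : r * s = 1) (i : Fin 3) :
    simpleRoot r s i * simpleRoot r s i = (r ^ 4 - r ^ 2 + 1) • 1 := by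
  fin_cases i <;>
  · simp only [simpleRoot, Fin.zero_eta, Fin.mk_one, Fin.reduceFinMk, cons_val]
    ext i j
    fin_cases i <;> fin_cases j <;> simp <;> grind

theorem simpleRoot_anticomm_zero_one (hrs : r * s = 1) :
    simpleRoot r s 0 * simpleRoot r s 1 + simpleRoot r s 1 * simpleRoot r s 0 = 0 := by
  simp only [simpleRoot, cons_val]
  ext i j
  fin_cases i <;> fin_cases j <;> simp <;> grind

theorem simpleRoot_anticomm_one_two :
    simpleRoot r s 1 * simpleRoot r s 2 + simpleRoot r s 2 * simpleRoot r s 1 =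
      (-(r ^ 4 - r ^ 2 + 1)) • 1 := by
  simp only [simpleRoot, cons_val]
  ext i j
  fin_cases i <;> fin_cases j <;> simp <;> grind

theorem simpleRoot_anticomm_zero_two (hrs : r * s = 1) :
    simpleRoot r s 0 * simpleRoot r s 2 + simpleRoot r s 2 * simpleRoot r s 0 =
      (-(r + s) * (r ^ 4 - r ^ 2 + 1)) • 1 := by
  simp only [simpleRoot, cons_val]
  ext i j
  fin_cases i <;> fin_cases j <;> simp <;> grind

theorem linearIndependent_simpleRoot (hrs : r * s = 1) (hd : r ^ 4 - r ^ 2 + 1 ≠ 0) :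
    LinearIndependent ℝ (simpleRoot r s) := by
  rw [Fintype.linearIndependent_iff]
  intro c hc
  have h : ∀ i j, (∑ k, c k • simpleRoot r s k) i j = 0 := fun i j => by rw [hc]; rfl
  have h00 := h 0 0
  have h01 := h 0 1
  have h10 := h 1 0
  simp only [simpleRoot, Fin.sum_univ_three, cons_val, Matrix.add_apply, Matrix.smul_apply,
    of_apply, cons_val', cons_val_fin_one, Complex.real_smul] at h00 h01 h10
  have h0 : (c 0 : ℂ) = 0 := by
    apply mul_left_cancel₀ hd
    grind
  have h1 : (c 1 : ℂ) = 0 := by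
    apply mul_left_cancel₀ hd
    grind
  have h2 : (c 2 : ℂ) = 0 := by
    rw [h0, h1] at h10
    simpa using h10
  intro i
  fin_cases i
  · exact_mod_cast h0
  · exact_mod_cast h1
  · exact_mod_cast h2

theorem simpleRoot_zero_mul_one (hrs : r * s = 1) {q : ℂˣ} (hq : (q : ℂ) = r ^ 2) :
    simpleRoot r s 0 * simpleRoot r s 1 =
      ((r ^ 4 - r ^ 2 + 1) * s) • (burauX q : Matrix (Fin 2) (Fin 2) ℂ) := by
  rw [coe_burauX, hq]
  simp only [simpleRoot, cons_val]
  ext i j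
  fin_cases i <;> fin_cases j <;> simp <;> grind

theorem simpleRoot_one_mul_two :
    simpleRoot r s 1 * simpleRoot r s 2 =
      (-(r ^ 4 - r ^ 2 + 1)) • (burauY ℂ : Matrix (Fin 2) (Fin 2) ℂ) := by
  rw [coe_burauY]
  simp only [simpleRoot, cons_val]
  ext i j
  fin_cases i <;> fin_cases j <;> simp <;> grind

theorem simpleRoot_zero_mul_two (hrs : r * s = 1) {q : ℂˣ} (hq : (q : ℂ) = r ^ 2) :
    simpleRoot r s 0 * simpleRoot r s 2 = (-((r ^ 4 - r ^ 2 + 1) * s)) •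
      ((burauX q * burauY ℂ : GL (Fin 2) ℂ) : Matrix (Fin 2) (Fin 2) ℂ) := by
  rw [burauX_mul_burauY, hq]
  simp only [simpleRoot, cons_val]
  ext i j
  fin_cases i <;> fin_cases j <;> simp <;> grind

/-- The projective representation of the `(2, 3, n)` triangle group at `q = exp (2πi / n)` is
faithful. -/
theorem mk_eq_one_of_burau_mem_center_of_sq {n : ℕ} (hn : 7 ≤ n) (hrs : r * s = 1)
    {q : ℂˣ} (hqr : (q : ℂ) = r ^ 2) (hq : IsPrimitiveRoot (q : ℂ) n)
    (hcos : ((2 * Real.cos (Real.pi / n) : ℝ) : ℂ) = r + s) {w : FreeGroup (Fin 2)}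
    (hw : burau q w ∈ Subgroup.center (GL (Fin 2) ℂ)) :
    PresentedGroup.mk (triangleRels 2 3 n) w = 1 := by
  have hd : r ^ 4 - r ^ 2 + 1 ≠ 0 := fun h => by
    have h6 : (q : ℂ) ^ 6 = 1 := by
      rw [hqr]
      linear_combination (r ^ 2 + 1) * (r ^ 6 - 1) * h
    have := Nat.le_of_dvd (by norm_num) (hq.dvd_of_pow_eq_one 6 h6)
    omega
  have hs : s ≠ 0 := right_ne_zero_of_mul_eq_one hrs
  set β := simpleRoot r s
  set d := r ^ 4 - r ^ 2 + 1
  have hβ : ∀ i, β i * β i = d • 1 := simpleRoot_mul_self hrs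
  have e01 := matrixReflection_mul hd (hβ 0) (hβ 1) (mul_ne_zero hd hs)
    (simpleRoot_zero_mul_one hrs hqr)
  have e12 := matrixReflection_mul hd (hβ 1) (hβ 2) (neg_ne_zero.2 hd) simpleRoot_one_mul_two
  have e02 := matrixReflection_mul hd (hβ 0) (hβ 2) (neg_ne_zero.2 (mul_ne_zero hd hs))
    (simpleRoot_zero_mul_two hrs hqr)
  have hn1 : n ≠ 1 := by omega
  have h2 : (2 : ℕ) ≠ 1 := by norm_num
  have h3 : (3 : ℕ) ≠ 1 := by norm_num
  let M := CoxeterMatrix.triangle 2 3 n h2 h3 hn1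
  let cs := M.toCoxeterSystem
  have hf : M.IsLiftable fun i => matrixReflection d (β i) :=
    CoxeterMatrix.isLiftable_triangle h2 h3 hn1 (fun i => matrixReflection_mul_self hd (hβ i))
      (by rw [e01, ← map_pow]; exact conjEnd_eq_one_of_mem_center (burauX_sq_mem_center q))
      (by rw [e12, ← map_pow]; exact conjEnd_eq_one_of_mem_center burauY_pow_three_mem_center)
      (by
        rw [e02, ← map_pow]
        exact conjEnd_eq_one_of_mem_center (burauX_mul_burauY_pow_mem_center hq (by omega)))
  let σ := cs.lift ⟨_, hf⟩
  have hσ : ∀ i, σ (cs.simple i) = matrixReflection d (β i) := cs.lift_apply_simple hf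
  have anti : ∀ i j, β i * β j + β j * β i =
      (-((2 * Real.cos (Real.pi / M i j) : ℝ) : ℂ) * d) • 1 := by
    have hdiag : ∀ i, β i * β i + β i * β i =
        (-((2 * Real.cos (Real.pi / (1 : ℕ)) : ℝ) : ℂ) * d) • 1 := fun i => by
      rw [hβ]
      norm_num
      module
    have h01 : β 0 * β 1 + β 1 * β 0 = (-((2 * Real.cos (Real.pi / (2 : ℕ)) : ℝ) : ℂ) * d) • 1 := by
      simpa using simpleRoot_anticomm_zero_one hrs
    have h12 : β 1 * β 2 + β 2 * β 1 = (-((2 * Real.cos (Real.pi / (3 : ℕ)) : ℝ) : ℂ) * d) • 1 := by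
      refine simpleRoot_anticomm_one_two.trans ?_
      norm_num [d]
    have h02 : β 0 * β 2 + β 2 * β 0 = (-((2 * Real.cos (Real.pi / n) : ℝ) : ℂ) * d) • 1 := by
      rw [hcos]
      exact simpleRoot_anticomm_zero_two hrs
    intro i j
    fin_cases i <;> fin_cases j
    · exact hdiag 0
    · exact h01
    · exact h02
    · exact (add_comm _ _).trans h01
    · exact hdiag 1
    · exact h12
    · exact (add_comm _ _).trans h02
    · exact (add_comm _ _).trans h12
    · exact hdiag 2
  have hconj : (σ.comp (toCoxeter h2 h3 hn1)).comp (PresentedGroup.mk (triangleRels 2 3 n)) =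
      conjEnd.comp (burau q) := by
    ext1 i
    fin_cases i
    · change σ (toCoxeter h2 h3 hn1 (PresentedGroup.of 0)) = conjEnd (burau q (FreeGroup.of 0))
      rw [toCoxeter_of_zero, map_mul, burau_of_zero, ← e01]
      exact congrArg₂ _ (hσ 0) (hσ 1)
    · change σ (toCoxeter h2 h3 hn1 (PresentedGroup.of 1)) = conjEnd (burau q (FreeGroup.of 1))
      rw [toCoxeter_of_one, map_mul, burau_of_one, ← e12]
      exact congrArg₂ _ (hσ 1) (hσ 2)
  refine toCoxeter_injective h2 h3 hn1 ?_
  rw [map_one]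
  refine cs.eq_one_of_map_apply_eq_self (σ := σ) (β := β) (fun i j => ?_)
    (linearIndependent_simpleRoot hrs hd) (fun i j => ?_) fun j => ?_
  · fin_cases i <;> fin_cases j <;> first
    | exact one_ne_zero | exact two_ne_zero | exact three_ne_zero | exact (by omega : n ≠ 0)
  · rw [hσ]
    exact matrixReflection_apply_of_anticomm hd (hβ i) (anti i j)
  · have h := DFunLike.congr_fun hconj w
    simp only [MonoidHom.comp_apply] at h
    rw [h, conjEnd_eq_one_of_mem_center hw, Module.End.one_apply]

end Triangle

theorem burau_mem_center_iff_of_isCyclotomicExtension {n : ℕ} [NeZero n] {L : Type*} [Field L]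
    [Algebra ℚ L] [IsCyclotomicExtension {n} ℚ L] {u : Lˣ} (hu : IsPrimitiveRoot (u : L) n) {q : ℂˣ}
    (hq : IsPrimitiveRoot (q : ℂ) n) {w : FreeGroup (Fin 2)} :
    burau q w ∈ Subgroup.center (GL (Fin 2) ℂ) ↔ burau u w ∈ Subgroup.center (GL (Fin 2) L) := by
  have hn := NeZero.pos n
  let e := hu.embeddingsEquivPrimitiveRoots ℂ (Polynomial.cyclotomic.irreducible_rat hn)
  let φ := e.symm ⟨q, (mem_primitiveRoots hn).2 hq⟩
  have hφ : Units.map (φ : L →+* ℂ) u = q := Units.ext <|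
    congrArg Subtype.val (e.apply_symm_apply ⟨q, (mem_primitiveRoots hn).2 hq⟩)
  rw [← hφ, ← map_burau, GeneralLinearGroup.map_mem_center_iff (RingHom.injective _)]

/-- Which words of the free group become scalar does not depend on the choice of the primitive root
of unity. -/
theorem burau_mem_center_iff_of_isPrimitiveRoot {n : ℕ} [NeZero n] {q q' : ℂˣ}
    (hq : IsPrimitiveRoot (q : ℂ) n) (hq' : IsPrimitiveRoot (q' : ℂ) n) {w : FreeGroup (Fin 2)} :
    burau q w ∈ Subgroup.center (GL (Fin 2) ℂ) ↔ burau q' w ∈ Subgroup.center (GL (Fin 2) ℂ) := by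
  have : NeZero (n : ℚ) := ⟨Nat.cast_ne_zero.2 (NeZero.ne n)⟩
  have : IsCyclotomicExtension {n} ℚ (CyclotomicField n ℚ) :=
    CyclotomicField.isCyclotomicExtension n ℚ
  obtain ⟨ζ, hζ⟩ := IsCyclotomicExtension.exists_isPrimitiveRoot ℚ
    (CyclotomicField n ℚ) (Set.mem_singleton n) (NeZero.ne n)
  have hu : IsPrimitiveRoot ((hζ.isUnit (NeZero.ne n)).unit : CyclotomicField n ℚ) n := hζ
  rw [burau_mem_center_iff_of_isCyclotomicExtension hu hq,
    burau_mem_center_iff_of_isCyclotomicExtension hu hq']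

namespace Triangle

/-- The projective representation of the `(2, 3, n)` triangle group at a primitive `n`-th root of
unity is faithful. -/
theorem mk_eq_one_of_burau_mem_center {n : ℕ} (hn : 7 ≤ n) {q : ℂˣ}
    (hq : IsPrimitiveRoot (q : ℂ) n) {w : FreeGroup (Fin 2)}
    (hw : burau q w ∈ Subgroup.center (GL (Fin 2) ℂ)) :
    PresentedGroup.mk (triangleRels 2 3 n) w = 1 := by
  have : NeZero n := ⟨by omega⟩
  let r := Complex.exp (Real.pi / n * Complex.I)
  have hr : Complex.exp (2 * Real.pi * Complex.I / n) = r ^ 2 := by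
    rw [← Complex.exp_nat_mul]
    congr 1
    push_cast
    ring
  have hprim := Complex.isPrimitiveRoot_exp n (by omega)
  refine mk_eq_one_of_burau_mem_center_of_sq hn (q := Units.mk0 _ (Complex.exp_ne_zero _))
    (r := r) (s := Complex.exp (-(Real.pi / n * Complex.I))) ?_ hr hprim ?_
    ((burau_mem_center_iff_of_isPrimitiveRoot hq hprim).1 hw)
  · rw [← Complex.exp_add, add_neg_cancel, Complex.exp_zero]
  · push_cast
    rw [Complex.two_cos, neg_mul]

/-- The projective representation of the `(2, 3, n)` triangle group at a primitive `n`-th root of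
unity. -/
noncomputable def toPGL {n : ℕ} (hn : 1 < n) {q : ℂˣ} (hq : IsPrimitiveRoot (q : ℂ) n) :
    Triangle 2 3 n →* PGL2 :=
  PresentedGroup.toGroup (f := ![pgl (burauX q), pgl (burauY ℂ)]) <| by
    have h : ∀ g : GL (Fin 2) ℂ, g ∈ Subgroup.center (GL (Fin 2) ℂ) → pgl g = 1 := fun g hg =>
      (QuotientGroup.eq_one_iff g).2 hg
    rintro r (rfl | rfl | rfl)
    · rw [map_pow, FreeGroup.lift_apply_of]
      exact (map_pow pgl _ _).symm.trans (h _ (burauX_sq_mem_center q))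
    · rw [map_pow, FreeGroup.lift_apply_of]
      exact (map_pow pgl _ _).symm.trans (h _ burauY_pow_three_mem_center)
    · rw [map_pow, map_mul, FreeGroup.lift_apply_of, FreeGroup.lift_apply_of]
      change (pgl (burauX q) * pgl (burauY ℂ)) ^ n = 1
      rw [← map_mul, ← map_pow]
      exact h _ (burauX_mul_burauY_pow_mem_center hq hn)

section

variable {n : ℕ} (hn : 1 < n) {q : ℂˣ} (hq : IsPrimitiveRoot (q : ℂ) n)

theorem toPGL_of_zero : toPGL hn hq (PresentedGroup.of 0) = pgl (burauX q) :=
  PresentedGroup.toGroup.of _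

theorem toPGL_of_one : toPGL hn hq (PresentedGroup.of 1) = pgl (burauY ℂ) :=
  PresentedGroup.toGroup.of _

theorem toPGL_mk (w : FreeGroup (Fin 2)) :
    toPGL hn hq (PresentedGroup.mk _ w) = pgl (burau q w) := by
  suffices (toPGL hn hq).comp (PresentedGroup.mk _) = pgl.comp (burau q) from
    DFunLike.congr_fun this w
  ext1 i
  fin_cases i
  · exact (toPGL_of_zero hn hq).trans (congrArg _ (burau_of_zero q)).symm
  · exact (toPGL_of_one hn hq).trans (congrArg _ (burau_of_one q)).symm

theorem toPGL_injective (h7 : 7 ≤ n) : Function.Injective (toPGL hn hq) := by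
  refine (injective_iff_map_eq_one _).2 fun g hg => ?_
  obtain ⟨w, rfl⟩ := PresentedGroup.mk_surjective _ g
  rw [toPGL_mk] at hg
  exact mk_eq_one_of_burau_mem_center h7 hq ((QuotientGroup.eq_one_iff _).1 hg)

theorem toPGL_yx_sq :
    toPGL hn hq ((PresentedGroup.of 1 * PresentedGroup.of 0) ^ 2) = Apr q := by
  rw [map_pow, map_mul, toPGL_of_zero, toPGL_of_one, ← map_mul, ← map_pow]
  refine congrArg pgl (Units.ext ?_)
  rw [AGL, dif_neg q.ne_zero, sq, Units.val_mul, burauY_mul_burauX]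
  change _ = !![(q : ℂ) ^ 2, 1 + q; 0, 1]
  rw [mul_fin_two]
  ext i j
  fin_cases i <;> fin_cases j <;> simp <;> ring

theorem toPGL_xy_sq :
    toPGL hn hq ((PresentedGroup.of 0 * PresentedGroup.of 1) ^ 2) = Bpr q := by
  rw [map_pow, map_mul, toPGL_of_zero, toPGL_of_one, ← map_mul, ← map_pow]
  refine congrArg pgl (Units.ext ?_)
  rw [BGL, dif_neg q.ne_zero, sq, Units.val_mul, burauX_mul_burauY]
  change _ = !![1, 0; -(q : ℂ) - (q : ℂ) ^ 2, (q : ℂ) ^ 2]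
  rw [mul_fin_two]
  ext i j
  fin_cases i <;> fin_cases j <;> simp <;> ring

end

/-- For odd `n`, the squares of `xy` and `yx` generate the `(2, 3, n)` triangle group. -/
theorem closure_sq_eq_top {n k : ℕ} (hn : n = 2 * k + 1) :
    Subgroup.closure {(PresentedGroup.of 1 * PresentedGroup.of 0 : Triangle 2 3 n) ^ 2,
      (PresentedGroup.of 0 * PresentedGroup.of 1 : Triangle 2 3 n) ^ 2} = ⊤ := by
  set x : Triangle 2 3 n := PresentedGroup.of 0
  set y : Triangle 2 3 n := PresentedGroup.of 1
  set H := Subgroup.closure {(y * x) ^ 2, (x * y) ^ 2}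
  have hx : x * x = 1 := by rw [← sq]; exact of_zero_pow 2 3 n
  have hy : y * y * y = 1 := by rw [← pow_three']; exact of_one_pow 2 3 n
  have hxy : (x * y) ^ n = 1 := mul_pow 2 3 n
  have hyx : (y * x) ^ n = 1 := mul_pow_eq_one_of_mul_eq_one (mul_inv_cancel y) hxy
  have odd : ∀ g : Triangle 2 3 n, g ^ n = 1 → g ^ 2 ∈ H → g ∈ H := fun g hg h => by
    have e : g = (g ^ 2) ^ (k + 1) := by
      rw [← pow_mul, show 2 * (k + 1) = n + 1 by omega, pow_succ, hg, one_mul]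
    rw [e]
    exact pow_mem h _
  have m1 : y * x ∈ H := odd _ hyx (Subgroup.subset_closure (Or.inl rfl))
  have m2 : x * y ∈ H := odd _ hxy (Subgroup.subset_closure (Or.inr rfl))
  have m3 : y * y ∈ H := by
    have := H.mul_mem m1 m2
    rwa [mul_assoc, ← mul_assoc x, hx, one_mul] at this
  have my : y ∈ H := by
    have := H.inv_mem m3
    rwa [inv_eq_of_mul_eq_one_right hy] at this
  have mx : x ∈ H := by
    have := H.mul_mem m2 (H.inv_mem my)
    rwa [mul_inv_cancel_right] at this
  rw [eq_top_iff, ← closure_eq_top 2 3 n, Subgroup.closure_le]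
  rintro g (rfl | rfl)
  · exact mx
  · exact my

/-- A subgroup of the `(2, 3, n)` triangle group generated by `m` elements of the kernel of the
projection to `PSL(2, ℤ/n)` is free if `6nm ≤ |PSL(2, ℤ/n)| (n - 6)`. -/
theorem isFreeGroup_closure_range {n m : ℕ} (h7 : 7 ≤ n)
    (hm : 6 * n * m + 6 * Nat.card (PSLZ n) ≤ Nat.card (PSLZ n) * n)
    (h : Fin m → Triangle 2 3 n) (hh : ∀ i, h i ∈ (triangleToPSL n).ker) :
    IsFreeGroup (Subgroup.closure (Set.range h)) := by
  have : NeZero n := ⟨by omega⟩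
  set H := Subgroup.closure (Set.range h) with hH
  have hle : H ≤ (triangleToPSL n).ker := by
    rw [hH, Subgroup.closure_le]
    rintro _ ⟨i, rfl⟩
    exact hh i
  have fixed : ∀ g : Triangle 2 3 n, triangleToPSL n g ≠ 1 →
      ∀ a : Triangle 2 3 n ⧸ H, g • a ≠ a := by
    intro g hg a
    induction a using QuotientGroup.induction_on with
    | H b =>
      intro hb
      have hb : ((g * b : Triangle 2 3 n) : Triangle 2 3 n ⧸ H) = b := hb
      have := hle (QuotientGroup.eq.1 hb.symm)
      rw [MonoidHom.mem_ker, map_mul, map_mul, map_inv, inv_mul_eq_one, right_eq_mul] at this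
      exact hg this
  have fx := fixed _ (triangleToPSL_of_zero_ne_one (n := n) (by omega))
  have fy := fixed _ (triangleToPSL_of_one_ne_one (n := n) (by omega))
  have fz : ∀ i : ℕ, 0 < i → i < n → ∀ a : Triangle 2 3 n ⧸ H,
      (PresentedGroup.of 0 * PresentedGroup.of 1 : Triangle 2 3 n) ^ i • a ≠ a :=
    fun i h0 hi => fixed _ (triangleToPSL_xy_pow_ne_one h0 hi)
  rcases finite_or_infinite (Triangle 2 3 n ⧸ H) with hfin | hinf
  · exfalso
    have h1 := le_of_closure_range_triangle (by omega) H fx fy fz h hH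
    have h2 : Nat.card (PSLZ n) ≤ H.index := by
      have := Subgroup.index_dvd_of_le hle
      rw [Subgroup.index_ker, MonoidHom.range_eq_top.2 (triangleToPSL_surjective n),
        Subgroup.card_top] at this
      exact Nat.le_of_dvd (Nat.pos_of_ne_zero H.index_ne_zero_of_finite) this
    obtain ⟨d, rfl⟩ := Nat.exists_eq_add_of_le h7
    nlinarith
  · exact isFreeGroup_of_infinite_quotient_triangle (by omega) H fx fy fz

variable {n k : ℕ} {q : ℂˣ}

theorem range_toPGL (hn : n = 2 * k + 1) (h1 : 1 < n) (hq : IsPrimitiveRoot (q : ℂ) n) :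
    (toPGL h1 hq).range = Gamma q := by
  rw [MonoidHom.range_eq_map, ← closure_sq_eq_top hn, MonoidHom.map_closure, Set.image_pair,
    toPGL_yx_sq, toPGL_xy_sq, Gamma]

/-- For odd `n ≥ 7` and `q` a primitive `n`-th root of unity, `Γ(q)` is the `(2, 3, n)` triangle
group. -/
noncomputable def equivGamma (hn : n = 2 * k + 1) (h7 : 7 ≤ n)
    (hq : IsPrimitiveRoot (q : ℂ) n) : Triangle 2 3 n ≃* Gamma q :=
  (MonoidHom.ofInjective (toPGL_injective (by omega) hq h7)).trans
    (MulEquiv.subgroupCongr (range_toPGL hn _ hq))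

theorem equivGamma_symm_Ain (hn : n = 2 * k + 1) (h7 : 7 ≤ n)
    (hq : IsPrimitiveRoot (q : ℂ) n) :
    (equivGamma hn h7 hq).symm (Ain q) = (PresentedGroup.of 1 * PresentedGroup.of 0) ^ 2 := by
  rw [MulEquiv.symm_apply_eq]
  exact Subtype.ext (toPGL_yx_sq (by omega) hq).symm

theorem equivGamma_symm_Bin (hn : n = 2 * k + 1) (h7 : 7 ≤ n)
    (hq : IsPrimitiveRoot (q : ℂ) n) :
    (equivGamma hn h7 hq).symm (Bin q) = (PresentedGroup.of 0 * PresentedGroup.of 1) ^ 2 := by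
  rw [MulEquiv.symm_apply_eq]
  exact Subtype.ext (toPGL_xy_sq (by omega) hq).symm

/-- The kernel of `Γ(q) → PSL(2, ℤ/n)` contains the normal closure of `S` and `T`. -/
theorem triangleToPSL_equivGamma_symm_eq_one (hn : n = 2 * k + 1) (h7 : 7 ≤ n)
    (hq : IsPrimitiveRoot (q : ℂ) n) {g : Gamma q}
    (hg : g ∈ Subgroup.normalClosure {Sel q k, Tel q k}) :
    triangleToPSL n ((equivGamma hn h7 hq).symm g) = 1 := by
  set χ := (triangleToPSL n).comp (equivGamma hn h7 hq).symm.toMonoidHom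
  have hA : χ (Ain q) = pslMk n (slUpper 2) := by
    change triangleToPSL n ((equivGamma hn h7 hq).symm (Ain q)) = _
    rw [equivGamma_symm_Ain, sq, map_mul, triangleToPSL_yx, ← map_mul, ← slUpper_add,
      one_add_one_eq_two]
  have hB : χ (Bin q) = pslMk n (slLower (-2)) := by
    change triangleToPSL n ((equivGamma hn h7 hq).symm (Bin q)) = _
    rw [equivGamma_symm_Bin, sq, map_mul, triangleToPSL_xy, ← map_mul, ← slLower_add, ← neg_add,
      one_add_one_eq_two]
  have hle : Subgroup.normalClosure {Sel q k, Tel q k} ≤ χ.ker := by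
    refine Subgroup.normalClosure_le_normal ?_
    rintro _ (rfl | rfl)
    · simpa only [Sel, SetLike.mem_coe, MonoidHom.mem_ker, map_mul, map_pow, map_zpow, map_inv, hA,
        hB] using (pslMk_slUpper_slLower_words hn).1
    · simpa only [Tel, SetLike.mem_coe, MonoidHom.mem_ker, map_mul, map_pow, map_zpow, map_inv, hA,
        hB] using (pslMk_slUpper_slLower_words hn).2
  exact hle hg

end Triangle

/-- For odd `n = 2k+1 ≥ 7`, `q` a primitive `n`-th root of unity, `N` the
normal closure of `{S, T}` in `Γ(q)`, and `f = |PSL(2, ℤ/nℤ)|·(n−6)/(6n)`, any `f` elements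
`x₁, …, x_f` of `N` generate a free subgroup of `Γ(q)`. -/
theorem stmt17 (n k : ℕ) (hn : n = 2 * k + 1) (h7 : 7 ≤ n)
    (q : ℂ) (hq : IsPrimitiveRoot q n)
    (f : ℕ) (hf : (f : ℚ) = (Nat.card (PSLZ n) : ℚ) * ((n : ℚ) - 6) / (6 * (n : ℚ)))
    (x : Fin f → ↥(Gamma q))
    (hx : ∀ i, x i ∈ Subgroup.normalClosure ({Sel q k, Tel q k} : Set ↥(Gamma q))) :
    IsFreeGroup ↥(Subgroup.closure (Set.range x)) := by
  obtain ⟨q, rfl⟩ : IsUnit q := hq.isUnit (by omega)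
  let e := Triangle.equivGamma hn h7 hq
  have hm : 6 * n * f + 6 * Nat.card (PSLZ n) ≤ Nat.card (PSLZ n) * n := by
    have h0 : (n : ℚ) ≠ 0 := Nat.cast_ne_zero.2 (by omega)
    rw [eq_div_iff (by positivity)] at hf
    have : 6 * n * (f : ℚ) + 6 * Nat.card (PSLZ n) = Nat.card (PSLZ n) * n := by
      linear_combination hf
    exact (by exact_mod_cast this : _ = _).le
  have hfree := Triangle.isFreeGroup_closure_range h7 hm (fun i => e.symm (x i)) fun i =>
    MonoidHom.mem_ker.2 (Triangle.triangleToPSL_equivGamma_symm_eq_one hn h7 hq (hx i))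
  have hmap : (Subgroup.closure (Set.range fun i => e.symm (x i))).map e.toMonoidHom =
      Subgroup.closure (Set.range x) := by
    rw [MonoidHom.map_closure, ← Set.range_comp]
    congr 2
    ext i
    simp
  rw [← hmap]
  exact IsFreeGroup.ofMulEquiv (Subgroup.equivMapOfInjective _ e.toMonoidHom e.injective)
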